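/- arXiv:2206.11852 — 2 statements merged into one kernel-verified Lean document; each statement's English description precedes it below -/
import Mathlib

section
/- Collapse of the SLOCC classes: let n ≥ 2, d ≥ 2, and let 𝒳 denote either the set of fully separable states or the set of biseparable states on (ℂ^d)^{⊗n}. For any pure states ψ₁ and ψ₂ on (ℂ^d)^{⊗n} with ψ₁ ∉ 𝒳 and ψ₂ ∉ 𝒳, there exist p ∈ (0,1] and a completely positive, trace non-increasing, 𝒳-preserving map Λ such that Λ(ψ₁) = p·ψ₂. -/
open Matrix Finset
open scoped ComplexOrder

attribute [local instance] Classical.propDecidable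

noncomputable section

/-- The rank-one matrix `|v⟩⟨v|` associated to a vector `v`. -/
def vecProj {D : Type*} [Fintype D] (v : D → ℂ) : Matrix D D ℂ :=
  Matrix.of fun i j => v i * star (v j)

/-- `v` is a unit vector. -/
def UnitVec {D : Type*} [Fintype D] (v : D → ℂ) : Prop :=
  ∑ i, star (v i) * v i = 1

/-- A quantum state: positive semidefinite matrix of trace one. -/
def IsState {D : Type*} [Fintype D] [DecidableEq D] (ρ : Matrix D D ℂ) : Prop :=
  ρ.PosSemidef ∧ ρ.trace = 1

/-- A vector on a multipartite system is fully product if it is a tensor product of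
single-party vectors. -/
def IsProdVec {ι : Type*} [Fintype ι] {Idx : ι → Type*} (v : (∀ i, Idx i) → ℂ) : Prop :=
  ∃ ψ : ∀ i, Idx i → ℂ, ∀ f, v f = ∏ i, ψ i (f i)

/-- A vector on a multipartite system is biseparable if it is a product across some
bipartition of the parties into a nonempty proper subset `M` and its complement. -/
def IsBisepVec {ι : Type*} [Fintype ι] {Idx : ι → Type*} (v : (∀ i, Idx i) → ℂ) : Prop :=
  ∃ M : Finset ι, M.Nonempty ∧ M ≠ Finset.univ ∧
    ∃ (a : ((j : {j : ι // j ∈ M}) → Idx j.1) → ℂ)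
      (b : ((j : {j : ι // j ∉ M}) → Idx j.1) → ℂ),
      ∀ f, v f = a (fun j => f j.1) * b (fun j => f j.1)

/-- Fully separable states: finite convex combinations of fully product pure states. -/
def FullySepState {ι : Type*} [Fintype ι] [DecidableEq ι] (Idx : ι → Type*)
    [∀ i, Fintype (Idx i)] (ρ : Matrix (∀ i, Idx i) (∀ i, Idx i) ℂ) : Prop :=
  ∃ (m : ℕ) (w : Fin m → ℝ) (u : Fin m → (∀ i, Idx i) → ℂ),
    (∀ k, 0 ≤ w k) ∧ (∑ k, w k = 1) ∧
    (∀ k, UnitVec (u k) ∧ IsProdVec (u k)) ∧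
    ρ = ∑ k, (w k : ℂ) • vecProj (u k)

/-- Biseparable states: finite convex combinations of biseparable pure states. -/
def BisepState {ι : Type*} [Fintype ι] [DecidableEq ι] (Idx : ι → Type*)
    [∀ i, Fintype (Idx i)] (ρ : Matrix (∀ i, Idx i) (∀ i, Idx i) ℂ) : Prop :=
  ∃ (m : ℕ) (w : Fin m → ℝ) (u : Fin m → (∀ i, Idx i) → ℂ),
    (∀ k, 0 ≤ w k) ∧ (∑ k, w k = 1) ∧
    (∀ k, UnitVec (u k) ∧ IsBisepVec (u k)) ∧
    ρ = ∑ k, (w k : ℂ) • vecProj (u k)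

/-- Completely positive, trace non-increasing map, given by a finite Kraus decomposition
with `∑ Kᵢ† Kᵢ ≤ 𝟙`. -/
def IsCPTNI {D : Type*} [Fintype D] [DecidableEq D]
    (Λ : Matrix D D ℂ → Matrix D D ℂ) : Prop :=
  ∃ (m : ℕ) (K : Fin m → Matrix D D ℂ),
    (∀ ρ, Λ ρ = ∑ i, K i * ρ * (K i)ᴴ) ∧
    ((1 : Matrix D D ℂ) - ∑ i, (K i)ᴴ * K i).PosSemidef

/-- Completely positive trace preserving map, given by a finite Kraus decomposition
with `∑ Kᵢ† Kᵢ = 𝟙`. -/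
def IsCPTP {D : Type*} [Fintype D] [DecidableEq D]
    (Λ : Matrix D D ℂ → Matrix D D ℂ) : Prop :=
  ∃ (m : ℕ) (K : Fin m → Matrix D D ℂ),
    (∀ ρ, Λ ρ = ∑ i, K i * ρ * (K i)ᴴ) ∧
    (∑ i, (K i)ᴴ * K i = 1)

/-- `Λ` preserves the set `S` of states: for every state `σ ∈ S` with `tr Λ(σ) ≠ 0`,
the normalised output lies in `S`. -/
def PreservesSet {D : Type*} [Fintype D] [DecidableEq D]
    (Λ : Matrix D D ℂ → Matrix D D ℂ) (S : Set (Matrix D D ℂ)) : Prop :=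
  ∀ σ, IsState σ → σ ∈ S → (Λ σ).trace ≠ 0 → ((Λ σ).trace)⁻¹ • Λ σ ∈ S


/-- Generic version of the separable states. -/
def GenState {D : Type*} [Fintype D] (P : (D → ℂ) → Prop) (ρ : Matrix D D ℂ) : Prop :=
  ∃ (m : ℕ) (w : Fin m → ℝ) (u : Fin m → D → ℂ),
    (∀ k, 0 ≤ w k) ∧ (∑ k, w k = 1) ∧
    (∀ k, UnitVec (u k) ∧ P (u k)) ∧
    ρ = ∑ k, (w k : ℂ) • vecProj (u k)

/-- squared norm -/
def nsq {D : Type*} [Fintype D] (u : D → ℂ) : ℝ := ∑ i, Complex.normSq (u i)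

lemma nsq_cast {D : Type*} [Fintype D] (u : D → ℂ) :
    ((nsq u : ℝ) : ℂ) = ∑ i, star (u i) * u i := by
  simp [nsq, Complex.normSq_eq_conj_mul_self]

lemma unitVec_iff {D : Type*} [Fintype D] (u : D → ℂ) : UnitVec u ↔ nsq u = 1 := by
  unfold UnitVec
  rw [← nsq_cast]
  exact_mod_cast Iff.rfl

lemma nsq_nonneg {D : Type*} [Fintype D] (u : D → ℂ) : 0 ≤ nsq u :=
  Finset.sum_nonneg fun i _ => Complex.normSq_nonneg _

lemma nsq_eq_zero {D : Type*} [Fintype D] {u : D → ℂ} (h : nsq u = 0) : u = 0 := by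
  funext i
  have := (Finset.sum_eq_zero_iff_of_nonneg
    (fun i _ => Complex.normSq_nonneg (u i))).1 h i (Finset.mem_univ i)
  simpa using this

lemma nsq_smul {D : Type*} [Fintype D] (c : ℂ) (u : D → ℂ) :
    nsq (fun i => c * u i) = Complex.normSq c * nsq u := by
  simp [nsq, Finset.mul_sum]

lemma vecProj_smul {D : Type*} [Fintype D] (c : ℂ) (u : D → ℂ) :
    vecProj (fun i => c * u i) = ((Complex.normSq c : ℝ) : ℂ) • vecProj u := by
  ext i j
  simp [vecProj, Complex.normSq_eq_conj_mul_self]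
  ring

lemma vecProj_eq {D : Type*} [Fintype D] (u : D → ℂ) :
    vecProj u = vecMulVec u (star u) := by
  ext i j; simp [vecProj, vecMulVec_apply]

lemma trace_vecProj {D : Type*} [Fintype D] (u : D → ℂ) :
    (vecProj u).trace = (nsq u : ℂ) := by
  rw [nsq_cast]; simp [vecProj, Matrix.trace, mul_comm]

lemma sum_sub_aux {κ M J : Type*} [Fintype κ] [Fintype J] [AddCommMonoid M] (p : κ → Prop)
    (e : J ≃ {k : κ // p k}) (F : κ → M) (hF : ∀ k, ¬ p k → F k = 0) :
    ∑ j, F (e j).1 = ∑ k, F k := by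
  classical
  rw [Equiv.sum_comp e (fun k => F k.1)]
  rw [← Finset.sum_subtype (Finset.univ.filter fun k : κ => p k) (by simp) F, Finset.sum_filter]
  refine Finset.sum_congr rfl fun k _ => ?_
  split_ifs with h
  · rfl
  · exact (hF k h).symm

/-- normalising an element of the cone -/
lemma gen_of_cone {D : Type*} [Fintype D] (P : (D → ℂ) → Prop)
    (hPs : ∀ (c : ℂ) u, P u → P (fun i => c * u i))
    {κ : Type*} [Fintype κ] (z : κ → D → ℂ) (t : κ → ℝ) (hz : ∀ k, P (z k))
    (ht : ∀ k, 0 ≤ t k) (ρ : Matrix D D ℂ) (hρ : ρ = ∑ k, (t k : ℂ) • vecProj (z k))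
    (htr : ρ.trace ≠ 0) : GenState P (ρ.trace⁻¹ • ρ) := by
  classical
  set T : ℝ := ∑ k, t k * nsq (z k) with hT
  have hTr : ρ.trace = (T : ℂ) := by
    rw [hρ, Matrix.trace_sum]
    simp [trace_vecProj, hT]
  have hT0 : T ≠ 0 := by
    intro h; apply htr; rw [hTr, h]; simp
  have hTn : 0 ≤ T := Finset.sum_nonneg fun k _ => mul_nonneg (ht k) (nsq_nonneg _)
  let κ' := {k : κ // nsq (z k) ≠ 0}
  let e := (Fintype.equivFin κ').symm
  have hsub : ∀ {M : Type} [AddCommMonoid M] (F : κ → M), (∀ k, nsq (z k) = 0 → F k = 0) →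
      ∑ j, F (e j).1 = ∑ k, F k := fun F hF => sum_sub_aux _ e F (by simpa using hF)
  have hcn : ∀ k : κ', Complex.normSq (((Real.sqrt (nsq (z k.1)))⁻¹ : ℝ) : ℂ)
      = (nsq (z k.1))⁻¹ := by
    intro k
    rw [Complex.normSq_ofReal, ← mul_inv, Real.mul_self_sqrt (nsq_nonneg _)]
  refine ⟨Fintype.card κ', fun j => T⁻¹ * (t (e j).1 * nsq (z (e j).1)),
    fun j i => (((Real.sqrt (nsq (z (e j).1)))⁻¹ : ℝ) : ℂ) * z (e j).1 i, ?_, ?_, ?_, ?_⟩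
  · intro k
    exact mul_nonneg (inv_nonneg.2 hTn) (mul_nonneg (ht _) (nsq_nonneg _))
  · rw [← Finset.mul_sum, hsub (fun k => t k * nsq (z k)) (by intro k h; simp [h]), ← hT,
      inv_mul_cancel₀ hT0]
  · intro k
    refine ⟨?_, hPs _ _ (hz _)⟩
    rw [unitVec_iff, nsq_smul, hcn, inv_mul_cancel₀ (e k).2]
  · rw [hTr]
    conv_lhs => rw [hρ]
    rw [← sum_sub_aux _ e (fun k => (t k : ℂ) • vecProj (z k))
      (by intro k h; rw [nsq_eq_zero (not_not.1 h)]; ext i j; simp [vecProj]), Finset.smul_sum]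
    refine Finset.sum_congr rfl fun j _ => ?_
    rw [vecProj_smul, hcn, smul_smul, smul_smul]
    congr 1
    have := (e j).2
    have h' : ((nsq (z (e j).1) : ℝ) : ℂ) ≠ 0 := by exact_mod_cast this
    push_cast
    field_simp

lemma isCPTNI_of_fintype {D : Type*} [Fintype D] [DecidableEq D]
    (Λ : Matrix D D ℂ → Matrix D D ℂ) {κ : Type*} [Fintype κ] (K : κ → Matrix D D ℂ)
    (h1 : ∀ ρ, Λ ρ = ∑ i, K i * ρ * (K i)ᴴ)
    (h2 : ((1 : Matrix D D ℂ) - ∑ i, (K i)ᴴ * K i).PosSemidef) : IsCPTNI Λ := by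
  let e := (Fintype.equivFin κ).symm
  refine ⟨Fintype.card κ, fun j => K (e j), ?_, ?_⟩
  · intro ρ
    rw [h1, Equiv.sum_comp e (fun k => K k * ρ * (K k)ᴴ)]
  · rw [Equiv.sum_comp e (fun k => (K k)ᴴ * K k)]
    exact h2

/-- overlap -/
def ovl {D : Type*} [Fintype D] (v u : D → ℂ) : ℂ := ∑ i, star (v i) * u i

lemma ovl_nsq {D : Type*} [Fintype D] (v u : D → ℂ) (hv : nsq v = 1) (hu : nsq u = 1) :
    nsq (fun i => u i - ovl v u * v i) = 1 - Complex.normSq (ovl v u) := by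
  have hv' := nsq_cast v
  have hu' := nsq_cast u
  have h : ((nsq (fun i => u i - ovl v u * v i) : ℝ) : ℂ)
      = ((1 - Complex.normSq (ovl v u) : ℝ) : ℂ) := by
    rw [nsq_cast]
    have h1 : ∀ i, star (u i - ovl v u * v i) * (u i - ovl v u * v i)
        = star (u i) * u i - ovl v u * (star (u i) * v i)
          - star (ovl v u) * (star (v i) * u i)
          + star (ovl v u) * ovl v u * (star (v i) * v i) := by
      intro i; simp; ring
    have h2 : ∑ i, star (u i) * v i = star (ovl v u) := by
      simp [ovl, mul_comm]
    have h3 : ∑ i, star (v i) * u i = ovl v u := rfl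
    rw [Finset.sum_congr rfl (fun i _ => h1 i), Finset.sum_add_distrib, Finset.sum_sub_distrib,
      Finset.sum_sub_distrib, ← Finset.mul_sum, ← Finset.mul_sum, ← Finset.mul_sum, ← hv', ← hu',
      h2, h3, hv, hu]
    push_cast
    rw [Complex.normSq_eq_conj_mul_self]
    simp
    ring
  exact_mod_cast h

lemma qform_vecProj {D : Type*} [Fintype D] (v u : D → ℂ) :
    star v ⬝ᵥ (vecProj u *ᵥ v) = (Complex.normSq (ovl v u) : ℂ) := by
  have h2 : ∑ i, star (u i) * v i = star (ovl v u) := by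
    simp [ovl, mul_comm]
  rw [vecProj_eq, vecMulVec_mulVec, Complex.normSq_eq_conj_mul_self]
  have : star u ⬝ᵥ v = star (ovl v u) := by rw [← h2]; rfl
  rw [this, dotProduct_smul]
  have : star v ⬝ᵥ u = ovl v u := rfl
  rw [this]
  simp [mul_comm]

lemma kraus_apply {D : Type*} [Fintype D] (a y : D → ℂ) (ρ : Matrix D D ℂ) :
    vecMulVec a (star y) * ρ * (vecMulVec a (star y))ᴴ = (star y ⬝ᵥ (ρ *ᵥ y)) • vecProj a := by
  rw [vecProj_eq, conjTranspose_vecMulVec, star_star, Matrix.mul_assoc, Matrix.mul_vecMulVec,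
    Matrix.vecMulVec_mul_vecMulVec]
  ext i j
  simp [vecMulVec_apply]
  try ring

lemma kraus_sq {D : Type*} [Fintype D] (a y : D → ℂ) :
    (vecMulVec a (star y))ᴴ * (vecMulVec a (star y)) = (nsq a : ℂ) • vecProj y := by
  rw [vecProj_eq, conjTranspose_vecMulVec, star_star, Matrix.vecMulVec_mul_vecMulVec]
  have : star a ⬝ᵥ a = (nsq a : ℂ) := by rw [nsq_cast]; rfl
  rw [this]
  ext i j
  simp [vecMulVec_apply]
  try ring

lemma core {D : Type*} [Fintype D] [DecidableEq D] (P : (D → ℂ) → Prop)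
    (hPs : ∀ (c : ℂ) u, P u → P (fun i => c * u i))
    (v₁ v₂ : D → ℂ) (hv₁ : nsq v₁ = 1) (hv₂ : nsq v₂ = 1)
    (lam : ℝ) (hlam : lam < 1)
    (hov : ∀ u, UnitVec u → P u → Complex.normSq (ovl v₁ u) ≤ lam)
    {κ : Type*} [Fintype κ] (z : κ → D → ℂ) (c : κ → ℝ) (hz : ∀ k, P (z k))
    (hdec : vecProj v₂ = ∑ k, (c k : ℂ) • vecProj (z k)) :
    ∃ p : ℝ, 0 < p ∧ p ≤ 1 ∧ ∃ Λ : Matrix D D ℂ → Matrix D D ℂ,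
        IsCPTNI Λ ∧ PreservesSet Λ {ρ | GenState P ρ} ∧
        Λ (vecProj v₁) = (p : ℂ) • vecProj v₂ := by
  set T : ℝ := ∑ k, nsq (z k) with hT
  have hT0 : 0 ≤ T := Finset.sum_nonneg fun k _ => nsq_nonneg _
  set b : ℝ := (T + 1)⁻¹ with hb
  have hb0 : 0 < b := by positivity
  have hbT : b * T ≤ 1 := by
    rw [hb, inv_mul_le_iff₀ (by positivity)]; linarith
  set C : ℝ := ∑ k, |c k| with hC
  have hC0 : 0 ≤ C := Finset.sum_nonneg fun k _ => abs_nonneg _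
  have hcC : ∀ k, |c k| ≤ C := fun k =>
    Finset.single_le_sum (f := fun k => |c k|) (fun k _ => abs_nonneg _) (Finset.mem_univ k)
  set a : ℝ := min 1 (b * (1 - lam) / (C + 1)) with ha
  have ha0 : 0 < a := by
    have : 0 < 1 - lam := by linarith
    exact lt_min one_pos (by positivity)
  have ha1 : a ≤ 1 := min_le_left _ _
  have haC : a * C ≤ b * (1 - lam) := by
    have h1 : a ≤ b * (1 - lam) / (C + 1) := min_le_right _ _
    rw [le_div_iff₀ (by positivity)] at h1
    nlinarith
  set Q : Matrix D D ℂ := 1 - vecProj v₁ with hQ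
  have hQh : Qᴴ = Q := by
    rw [hQ, conjTranspose_sub, conjTranspose_one, vecProj_eq, conjTranspose_vecMulVec, star_star]
  have hvv : star v₁ ⬝ᵥ v₁ = 1 := by
    have := nsq_cast v₁
    rw [hv₁] at this
    simpa [dotProduct] using this.symm
  have hpp : vecProj v₁ * vecProj v₁ = vecProj v₁ := by
    rw [vecProj_eq, vecMulVec_mul_vecMulVec, hvv]; simp
  have hQQ : Q * Q = Q := by
    rw [hQ]; simp [sub_mul, mul_sub, hpp]
  let y : D → D → ℂ := fun x j => Q j x
  have hysum : ∑ x, vecProj (y x) = Q := by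
    conv_rhs => rw [← hQQ]
    nth_rewrite 2 [← hQh]
    ext i j
    simp [vecProj, y, Matrix.mul_apply, Matrix.sum_apply]
  have hyq : ∀ ρ : Matrix D D ℂ, ∑ x, star (y x) ⬝ᵥ (ρ *ᵥ (y x))
      = ρ.trace - star v₁ ⬝ᵥ (ρ *ᵥ v₁) := by
    intro ρ
    have h1 : ∑ x, star (y x) ⬝ᵥ (ρ *ᵥ (y x)) = (Qᴴ * (ρ * Q)).trace := by
      simp only [Matrix.trace, Matrix.diag, Matrix.mul_apply, dotProduct, mulVec]
      rfl
    rw [h1, hQh, Matrix.trace_mul_comm, Matrix.mul_assoc, hQQ, hQ, mul_sub, Matrix.trace_sub,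
      Matrix.mul_one, vecProj_eq, Matrix.mul_vecMulVec, Matrix.trace_vecMulVec,
      dotProduct_comm]
  let Λ : Matrix D D ℂ → Matrix D D ℂ := fun ρ =>
    ((a : ℂ) * (star v₁ ⬝ᵥ (ρ *ᵥ v₁))) • vecProj v₂ +
      ((b : ℂ) * (ρ.trace - star v₁ ⬝ᵥ (ρ *ᵥ v₁))) • ∑ k, vecProj (z k)
  let K : Unit ⊕ (κ × D) → Matrix D D ℂ := fun s => match s with
    | Sum.inl _ => vecMulVec (fun i => ((Real.sqrt a : ℝ) : ℂ) * v₂ i) (star v₁)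
    | Sum.inr (k, x) => vecMulVec (fun i => ((Real.sqrt b : ℝ) : ℂ) * z k i) (star (y x))
  have hsa : Complex.normSq ((Real.sqrt a : ℝ) : ℂ) = a := by
    rw [Complex.normSq_ofReal, Real.mul_self_sqrt ha0.le]
  have hsb : Complex.normSq ((Real.sqrt b : ℝ) : ℂ) = b := by
    rw [Complex.normSq_ofReal, Real.mul_self_sqrt hb0.le]
  refine ⟨a, ha0, ha1, Λ, isCPTNI_of_fintype Λ K ?_ ?_, ?_, ?_⟩
  · intro ρ
    rw [Fintype.sum_sum_type, Fintype.sum_prod_type]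
    simp only [K, Λ, Finset.univ_unique, Finset.sum_singleton, kraus_apply, vecProj_smul,
      hsa, hsb, ← Finset.sum_smul, hyq, Finset.smul_sum]
    congr 1
    · rw [smul_smul, mul_comm]
    · refine Finset.sum_congr rfl fun k _ => ?_
      rw [smul_smul, mul_comm]
  · rw [Fintype.sum_sum_type, Fintype.sum_prod_type]
    simp only [K, Finset.univ_unique, Finset.sum_singleton, kraus_sq, nsq_smul,
      hsa, hsb, ← Finset.smul_sum, hysum, ← Finset.sum_smul, hv₂]
    have hsumT : ∑ k, ((b * nsq (z k) : ℝ) : ℂ) = ((b * T : ℝ) : ℂ) := by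
      rw [hT, Finset.mul_sum]; push_cast; rfl
    rw [hsumT]
    have hrw : (1 : Matrix D D ℂ) - (((a * 1 : ℝ) : ℂ) • vecProj v₁ + ((b * T : ℝ) : ℂ) • Q)
        = ((1 - a : ℝ) : ℂ) • vecProj v₁ + ((1 - b * T : ℝ) : ℂ) • Q := by
      have : (1 : Matrix D D ℂ) = vecProj v₁ + Q := by rw [hQ]; simp
      rw [this]
      push_cast
      module
    rw [hrw]
    have hp1 : (vecProj v₁).PosSemidef := by
      rw [vecProj_eq]; exact posSemidef_vecMulVec_self_star v₁
    have hp2 : Q.PosSemidef := by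
      have := posSemidef_self_mul_conjTranspose Q
      rwa [hQh, hQQ] at this
    refine (hp1.smul ?_).add (hp2.smul ?_)
    · exact_mod_cast sub_nonneg.2 ha1
    · exact_mod_cast sub_nonneg.2 hbT
  · intro σ hσ hS htr
    obtain ⟨m, w, u, hw, hw1, hu, hσu⟩ := hS
    set q : ℝ := ∑ k, w k * Complex.normSq (ovl v₁ (u k)) with hq
    have hqσ : star v₁ ⬝ᵥ (σ *ᵥ v₁) = (q : ℂ) := by
      rw [hσu, Matrix.sum_mulVec, dotProduct_sum]
      simp [Matrix.smul_mulVec, qform_vecProj, hq]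
    have hq0 : 0 ≤ q := Finset.sum_nonneg fun k _ => mul_nonneg (hw k) (Complex.normSq_nonneg _)
    have hql : q ≤ lam := by
      calc q ≤ ∑ k, w k * lam := Finset.sum_le_sum fun k _ =>
            mul_le_mul_of_nonneg_left (hov _ (hu k).1 (hu k).2) (hw k)
        _ = lam := by rw [← Finset.sum_mul, hw1, one_mul]
    refine gen_of_cone P hPs z (fun k => a * q * c k + b * (1 - q)) hz ?_ (Λ σ) ?_ htr
    · intro k
      have h1 : -(c k) ≤ C := (neg_le_abs _).trans (hcC k)
      have h2 : a * q * (-(c k)) ≤ a * q * C :=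
        mul_le_mul_of_nonneg_left h1 (by positivity)
      have h3 : q * (a * C) ≤ 1 * (a * C) :=
        mul_le_mul_of_nonneg_right (by linarith) (by positivity)
      have h4 : b * (1 - lam) ≤ b * (1 - q) :=
        mul_le_mul_of_nonneg_left (by linarith) hb0.le
      nlinarith
    · simp only [Λ]
      rw [hqσ, hσ.2, hdec, Finset.smul_sum, Finset.smul_sum, ← Finset.sum_add_distrib]
      refine Finset.sum_congr rfl fun k _ => ?_
      rw [smul_smul, ← add_smul]
      push_cast
      rfl
  · simp only [Λ]
    have h1 : star v₁ ⬝ᵥ (vecProj v₁ *ᵥ v₁) = 1 := by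
      rw [vecProj_eq, vecMulVec_mulVec, hvv]; simpa using hvv
    rw [h1, trace_vecProj, hv₁]
    simp

/-- compactness bound for the overlap -/
lemma overlap_bound {D : Type*} [Fintype D] (P : (D → ℂ) → Prop)
    (hPs : ∀ (c : ℂ) u, P u → P (fun i => c * u i))
    (F : Set (D → ℂ)) (hF : IsClosed F) (hPF : ∀ u, UnitVec u → (P u ↔ u ∈ F))
    (v : D → ℂ) (hv : UnitVec v) (hvP : ¬ P v) :
    ∃ lam : ℝ, lam < 1 ∧ ∀ u, UnitVec u → P u → Complex.normSq (ovl v u) ≤ lam := by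
  have hlt : ∀ u, UnitVec u → P u → Complex.normSq (ovl v u) < 1 := by
    intro u hu hPu
    have h := ovl_nsq v u ((unitVec_iff v).1 hv) ((unitVec_iff u).1 hu)
    have h0 := nsq_nonneg (fun i => u i - ovl v u * v i)
    refine lt_of_le_of_ne (by linarith) fun h1 => hvP ?_
    have h2 := nsq_eq_zero (h.trans (by rw [h1]; simp))
    have h3 : ovl v u ≠ 0 := by
      intro h; rw [h] at h1; simp at h1
    have h4 : v = fun i => (ovl v u)⁻¹ * u i := by
      funext i
      have := congrFun h2 i
      simp only [Pi.zero_apply, sub_eq_zero] at this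
      rw [this, inv_mul_cancel_left₀ h3]
    rw [h4]
    exact hPs _ _ hPu
  have hcn : Continuous (fun u : D → ℂ => nsq u) := by
    unfold nsq
    exact continuous_finset_sum _ fun i _ => Complex.continuous_normSq.comp (continuous_apply i)
  have hco : Continuous (fun u : D → ℂ => Complex.normSq (ovl v u)) := by
    refine Complex.continuous_normSq.comp ?_
    unfold ovl
    fun_prop
  let S : Set (D → ℂ) := {u | nsq u = 1} ∩ F
  have hSc : IsClosed S := (isClosed_eq hcn continuous_const).inter hF
  have hSb : Bornology.IsBounded S := by
    refine (Metric.isBounded_closedBall (x := (0 : D → ℂ)) (r := 1)).subset ?_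
    rintro u ⟨hu, -⟩
    rw [mem_closedBall_zero_iff, pi_norm_le_iff_of_nonneg zero_le_one]
    intro i
    have h1 : Complex.normSq (u i) ≤ 1 := by
      rw [← (show nsq u = 1 from hu)]
      exact Finset.single_le_sum (f := fun i => Complex.normSq (u i))
        (fun i _ => Complex.normSq_nonneg _) (Finset.mem_univ i)
    rw [Complex.normSq_eq_norm_sq] at h1
    exact (sq_le_one_iff₀ (norm_nonneg _)).1 h1
  have hSk : IsCompact S := Metric.isCompact_of_isClosed_isBounded hSc hSb
  rcases S.eq_empty_or_nonempty with hE | hN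
  · refine ⟨0, zero_lt_one, fun u hu hP => ?_⟩
    have : u ∈ S := ⟨(unitVec_iff u).1 hu, (hPF u hu).1 hP⟩
    rw [hE] at this
    exact this.elim
  · obtain ⟨u₀, hu₀, hmax⟩ := hSk.exists_isMaxOn hN hco.continuousOn
    have hu1 : UnitVec u₀ := (unitVec_iff u₀).2 hu₀.1
    refine ⟨_, hlt u₀ hu1 ((hPF _ hu1).2 hu₀.2), fun u hu hP => ?_⟩
    exact hmax (show u ∈ S from ⟨(unitVec_iff u).1 hu, (hPF u hu).1 hP⟩)

lemma pol1 {d : ℕ} (f g x y : Fin d) :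
    ∑ k : Fin 4, (Complex.I ^ (k : ℕ) / 4) *
      (((if x = f then 1 else 0) + Complex.I ^ (k : ℕ) * (if x = g then 1 else 0)) *
      star ((if y = f then 1 else 0) + Complex.I ^ (k : ℕ) * (if y = g then (1 : ℂ) else 0)))
    = (if x = f then 1 else 0) * (if y = g then 1 else 0) := by
  have h3 : Complex.I ^ 3 = - Complex.I := by rw [pow_succ, Complex.I_sq]; ring
  simp only [Fin.sum_univ_four]
  split_ifs <;> simp [h3] <;> ring_nf <;> simp [h3] <;> try ring

/-- the spanning family of product vectors -/
def polVec {n d : ℕ} (s : (Fin n → Fin d) × (Fin n → Fin d) × (Fin n → Fin 4)) :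
    (Fin n → Fin d) → ℂ := fun x =>
  ∏ i, ((if x i = s.1 i then 1 else 0) +
    Complex.I ^ (s.2.2 i : ℕ) * (if x i = s.2.1 i then (1 : ℂ) else 0))

lemma polVec_prod {n d : ℕ} (s : (Fin n → Fin d) × (Fin n → Fin d) × (Fin n → Fin 4)) :
    IsProdVec (Idx := fun _ : Fin n => Fin d) (polVec s) :=
  ⟨fun i t => (if t = s.1 i then 1 else 0) +
    Complex.I ^ (s.2.2 i : ℕ) * (if t = s.2.1 i then (1 : ℂ) else 0), fun _ => rfl⟩

lemma prod_ite_eq' {n d : ℕ} (x f : Fin n → Fin d) :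
    ∏ i, (if x i = f i then (1 : ℂ) else 0) = if x = f then 1 else 0 := by
  split_ifs with h
  · simp [h]
  · obtain ⟨i, hi⟩ := Function.ne_iff.1 h
    exact Finset.prod_eq_zero (Finset.mem_univ i) (by simp [hi])

lemma polVec_dec {n d : ℕ} (v : (Fin n → Fin d) → ℂ) :
    ∃ c : (Fin n → Fin d) × (Fin n → Fin d) × (Fin n → Fin 4) → ℝ,
      vecProj v = ∑ s, (c s : ℂ) • vecProj (polVec s) := by
  let C : (Fin n → Fin d) × (Fin n → Fin d) × (Fin n → Fin 4) → ℂ := fun s =>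
    v s.1 * star (v s.2.1) * ∏ i, (Complex.I ^ (s.2.2 i : ℕ) / 4)
  have h1 : vecProj v = ∑ s, C s • vecProj (polVec s) := by
    ext x y
    rw [Matrix.sum_apply, Fintype.sum_prod_type]
    simp only [Fintype.sum_prod_type]
    have key : ∀ f g : Fin n → Fin d,
        ∑ κ : Fin n → Fin 4, (C (f, g, κ) • vecProj (polVec (f, g, κ))) x y
        = v f * star (v g) * ((if x = f then 1 else 0) * (if y = g then 1 else 0)) := by
      intro f g
      rw [← prod_ite_eq' x f, ← prod_ite_eq' y g, ← Finset.prod_mul_distrib]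
      simp only [← pol1]
      rw [Fintype.prod_sum, Finset.mul_sum]
      refine Finset.sum_congr rfl fun κ _ => ?_
      simp only [C, vecProj, polVec, Matrix.smul_apply, Matrix.of_apply, smul_eq_mul, star_prod,
        Finset.prod_mul_distrib]
      ring
    simp only [key]
    simp [vecProj]
  refine ⟨fun s => (C s).re, ?_⟩
  have h2 : vecProj v = ∑ s, star (C s) • vecProj (polVec s) := by
    have hH : ∀ u : (Fin n → Fin d) → ℂ, (vecProj u)ᴴ = vecProj u := fun u => by
      rw [vecProj_eq, conjTranspose_vecMulVec, star_star]
    have := congrArg conjTranspose h1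
    simpa only [hH, conjTranspose_sum, conjTranspose_smul] using this
  have h3 : vecProj v = (2⁻¹ : ℂ) • (vecProj v + vecProj v) := by
    rw [← two_smul ℂ, smul_smul]; norm_num
  rw [h3]
  nth_rewrite 1 [h1]
  rw [h2, ← Finset.sum_add_distrib, Finset.smul_sum]
  refine Finset.sum_congr rfl fun s _ => ?_
  rw [← add_smul, smul_smul]
  congr 1
  rw [Complex.re_eq_add_conj]
  simp
  ring

/-- exchange relation across a bipartition -/
def Exch {n d : ℕ} (M : Finset (Fin n)) (v : (Fin n → Fin d) → ℂ) : Prop :=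
  ∀ f g, v f * v g = v (M.piecewise f g) * v (M.piecewise g f)

lemma exch_closed {n d : ℕ} (M : Finset (Fin n)) :
    IsClosed {v : (Fin n → Fin d) → ℂ | Exch M v} := by
  simp only [Exch, Set.setOf_forall]
  refine isClosed_iInter fun f => isClosed_iInter fun g => isClosed_eq ?_ ?_ <;> fun_prop

lemma unit_ne {D : Type*} [Fintype D] {v : D → ℂ} (h : UnitVec v) : ∃ f, v f ≠ 0 := by
  by_contra! hc
  simp [UnitVec, hc] at h

lemma prod_iff {n d : ℕ} (hn : 2 ≤ n) (v : (Fin n → Fin d) → ℂ) (hv : UnitVec v) :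
    IsProdVec (Idx := fun _ : Fin n => Fin d) v ↔ ∀ M, Exch M v := by
  constructor
  · rintro ⟨ψ, hψ⟩ M f g
    simp only [hψ, ← Finset.prod_mul_distrib]
    refine Finset.prod_congr rfl fun i _ => ?_
    by_cases h : i ∈ M <;> simp [h, mul_comm]
  · intro h
    obtain ⟨f₀, hf₀⟩ := unit_ne hv
    have key : ∀ (f : Fin n → Fin d) (M : Finset (Fin n)),
        v (M.piecewise f f₀) = v f₀ * ∏ i ∈ M, (v (Function.update f₀ i (f i)) / v f₀) := by
      intro f M
      induction M using Finset.induction_on with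
      | empty => simp
      | insert i M hi ih =>
        rw [Finset.prod_insert hi]
        have h1 := h {i} ((insert i M).piecewise f f₀) f₀
        have e1 : ({i} : Finset (Fin n)).piecewise ((insert i M).piecewise f f₀) f₀
            = Function.update f₀ i (f i) := by
          funext j
          by_cases hj : j = i
          · subst hj; simp
          · simp [hj]
        have e2 : ({i} : Finset (Fin n)).piecewise f₀ ((insert i M).piecewise f f₀)
            = M.piecewise f f₀ := by
          funext j
          by_cases hj : j = i
          · subst hj; simp [hi]
          · by_cases hm : j ∈ M <;> simp [hj, hm]
        rw [e1, e2, ih] at h1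
        field_simp
        field_simp at h1
        linear_combination h1
    let i₀ : Fin n := ⟨0, by omega⟩
    · refine ⟨fun i t => (if i = i₀ then v f₀ else 1) * (v (Function.update f₀ i t) / v f₀),
        fun f => ?_⟩
      have := key f Finset.univ
      rw [Finset.piecewise_univ] at this
      rw [this, Finset.prod_mul_distrib]
      simp

lemma bisep_iff {n d : ℕ} (v : (Fin n → Fin d) → ℂ) (hv : UnitVec v) :
    IsBisepVec (Idx := fun _ : Fin n => Fin d) v ↔
      ∃ M : Finset (Fin n), (M.Nonempty ∧ M ≠ Finset.univ) ∧ Exch M v := by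
  constructor
  · rintro ⟨M, h1, h2, a, b, hab⟩
    refine ⟨M, ⟨h1, h2⟩, fun f g => ?_⟩
    have e1 : ∀ f g : Fin n → Fin d, (fun j : {j // j ∈ M} => M.piecewise f g j.1)
        = fun j => f j.1 := by
      intro f g; funext j; simp [j.2]
    have e2 : ∀ f g : Fin n → Fin d, (fun j : {j // j ∉ M} => M.piecewise f g j.1)
        = fun j => g j.1 := by
      intro f g; funext j; simp [j.2]
    rw [hab f, hab g, hab (M.piecewise f g), hab (M.piecewise g f), e1, e1, e2, e2]
    ring
  · rintro ⟨M, ⟨h1, h2⟩, h⟩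
    obtain ⟨f₀, hf₀⟩ := unit_ne hv
    refine ⟨M, h1, h2, fun x => v (fun j => if hj : j ∈ M then x ⟨j, hj⟩ else f₀ j) / v f₀,
      fun x => v (fun j => if hj : j ∈ M then f₀ j else x ⟨j, hj⟩), fun f => ?_⟩
    have e1 : (fun j => if hj : j ∈ M then f j else f₀ j) = M.piecewise f f₀ := by
      funext j; by_cases hj : j ∈ M <;> simp [hj]
    have e2 : (fun j => if hj : j ∈ M then f₀ j else f j) = M.piecewise f₀ f := by
      funext j; by_cases hj : j ∈ M <;> simp [hj]
    have h3 := h f f₀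
    simp only [e1, e2]
    field_simp
    exact h3

lemma prod_bisep {n d : ℕ} (hn : 2 ≤ n) (v : (Fin n → Fin d) → ℂ)
    (hv : IsProdVec (Idx := fun _ : Fin n => Fin d) v) :
    IsBisepVec (Idx := fun _ : Fin n => Fin d) v := by
  obtain ⟨ψ, hψ⟩ := hv
  let i₀ : Fin n := ⟨0, by omega⟩
  let i₁ : Fin n := ⟨1, by omega⟩
  have hne : i₁ ≠ i₀ := by simp [i₀, i₁]
  refine ⟨{i₀}, by simp, ?_, fun x => ∏ j, ψ j.1 (x j), fun x => ∏ j, ψ j.1 (x j), fun f => ?_⟩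
  · intro h
    have : i₁ ∈ ({i₀} : Finset (Fin n)) := by rw [h]; simp
    exact hne (by simpa using this)
  · rw [hψ]
    refine (Fintype.prod_subtype_mul_prod_subtype (fun j => j ∈ ({i₀} : Finset (Fin n)))
      (fun j => ψ j (f j))).symm.trans ?_
    congr!

lemma prod_smul {n d : ℕ} (hn : 2 ≤ n) (c : ℂ) (v : (Fin n → Fin d) → ℂ)
    (hv : IsProdVec (Idx := fun _ : Fin n => Fin d) v) :
    IsProdVec (Idx := fun _ : Fin n => Fin d) (fun f => c * v f) := by
  obtain ⟨ψ, hψ⟩ := hv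
  let i₀ : Fin n := ⟨0, by omega⟩
  refine ⟨fun i t => (if i = i₀ then c else 1) * ψ i t, fun f => ?_⟩
  simp only [hψ, Finset.prod_mul_distrib]
  simp

lemma bisep_smul {n d : ℕ} (c : ℂ) (v : (Fin n → Fin d) → ℂ)
    (hv : IsBisepVec (Idx := fun _ : Fin n => Fin d) v) :
    IsBisepVec (Idx := fun _ : Fin n => Fin d) (fun f => c * v f) := by
  obtain ⟨M, h1, h2, a, b, h⟩ := hv
  exact ⟨M, h1, h2, fun x => c * a x, b, fun f => by simp only [h]; ring⟩

lemma gen_pure {D : Type*} [Fintype D] (P : (D → ℂ) → Prop) (v : D → ℂ) (hv : UnitVec v)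
    (hP : P v) : GenState P (vecProj v) :=
  ⟨1, fun _ => 1, fun _ => v, by simp, by simp, fun _ => ⟨hv, hP⟩, by simp⟩

/-- **Collapse of the SLOCC classes.** In a resource theory of entanglement where the
free operations are 𝒳-preserving maps (𝒳 being full separability or biseparability),
all resource states are interconvertible with non-zero probability. -/
theorem collapse_of_SLOCC_classes (n d : ℕ) (hn : 2 ≤ n) (hd : 2 ≤ d)
    (S : Set (Matrix (Fin n → Fin d) (Fin n → Fin d) ℂ))
    (hS : S = {ρ | FullySepState (fun _ : Fin n => Fin d) ρ} ∨
          S = {ρ | BisepState (fun _ : Fin n => Fin d) ρ})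
    (v₁ v₂ : (Fin n → Fin d) → ℂ) (hv₁ : UnitVec v₁) (hv₂ : UnitVec v₂)
    (h₁ : vecProj v₁ ∉ S) (h₂ : vecProj v₂ ∉ S) :
    ∃ p : ℝ, 0 < p ∧ p ≤ 1 ∧
      ∃ Λ : Matrix (Fin n → Fin d) (Fin n → Fin d) ℂ →
            Matrix (Fin n → Fin d) (Fin n → Fin d) ℂ,
        IsCPTNI Λ ∧ PreservesSet Λ S ∧ Λ (vecProj v₁) = (p : ℂ) • vecProj v₂ := by
  obtain ⟨c, hc⟩ := polVec_dec v₂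
  rcases hS with hS | hS
  · subst hS
    let P : ((Fin n → Fin d) → ℂ) → Prop := IsProdVec (Idx := fun _ : Fin n => Fin d)
    have hvP : ¬ P v₁ := fun h => h₁ (gen_pure P v₁ hv₁ h)
    have hcl : IsClosed {v : (Fin n → Fin d) → ℂ | ∀ M, Exch M v} := by
      rw [Set.setOf_forall]
      exact isClosed_iInter fun M => exch_closed M
    obtain ⟨lam, hl, hov⟩ := overlap_bound P (prod_smul hn) _ hcl (prod_iff hn) v₁ hv₁ hvP
    exact core P (prod_smul hn) v₁ v₂ ((unitVec_iff _).1 hv₁) ((unitVec_iff _).1 hv₂) lam hl hov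
      polVec c polVec_prod hc
  · subst hS
    let P : ((Fin n → Fin d) → ℂ) → Prop := IsBisepVec (Idx := fun _ : Fin n => Fin d)
    have hvP : ¬ P v₁ := fun h => h₁ (gen_pure P v₁ hv₁ h)
    have hcl : IsClosed {v : (Fin n → Fin d) → ℂ |
        ∃ M : Finset (Fin n), (M.Nonempty ∧ M ≠ Finset.univ) ∧ Exch M v} := by
      rw [Set.setOf_exists]
      refine isClosed_iUnion_of_finite fun M => ?_
      rw [Set.setOf_and]
      exact isClosed_const.inter (exch_closed M)
    obtain ⟨lam, hl, hov⟩ := overlap_bound P bisep_smul _ hcl bisep_iff v₁ hv₁ hvP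
    exact core P bisep_smul v₁ v₂ ((unitVec_iff _).1 hv₁) ((unitVec_iff _).1 hv₂) lam hl hov
      polVec c (fun s => prod_bisep hn _ (polVec_prod s)) hc
end
end

section
/- In the resource theory whose free operations are the full separability-preserving maps, there is no maximally entangled state on (ℂ²)^{⊗3}: there exists no state ρ* on (ℂ²)^{⊗3} such that for every state ρ on (ℂ²)^{⊗3} there is a CPTP FSP map Λ with Λ(ρ*) = ρ. Moreover, there exists no CPTP FSP map Λ with Λ(|W⟩⟨W|) = |GHZ⟩⟨GHZ|, where |W⟩ = (|001⟩+|010⟩+|100⟩)/√3 and |GHZ⟩ = (|000⟩+|111⟩)/√2. -/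
open Matrix Finset
open scoped ComplexOrder

attribute [local instance] Classical.propDecidable

noncomputable section

/-- The three-qubit GHZ vector `(|000⟩ + |111⟩)/√2`. -/
def ghzVec : (Fin 3 → Fin 2) → ℂ := fun f =>
  if f = (fun _ => (0 : Fin 2)) ∨ f = (fun _ => (1 : Fin 2)) then
    (((Real.sqrt 2)⁻¹ : ℝ) : ℂ) else 0

/-- The three-qubit W vector `(|001⟩ + |010⟩ + |100⟩)/√3`. -/
def wVec : (Fin 3 → Fin 2) → ℂ := fun f =>
  if (∑ i, ((f i : ℕ))) = 1 then (((Real.sqrt 3)⁻¹ : ℝ) : ℂ) else 0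


/-- squared norm of a complex number -/
abbrev nq (z : ℂ) : ℝ := Complex.normSq z

lemma disc_aux (a b c : ℝ) (h : ∀ s : ℝ, 0 ≤ a - 2 * s * c + s ^ 2 * c * b) (ha : 0 ≤ a) (hb : 0 ≤ b)
    (hc : 0 ≤ c) : c ≤ a * b := by
  have h1 : discrim (c * b) (-2 * c) a ≤ 0 := by
    apply discrim_le_zero
    intro s
    have := h s
    nlinarith
  unfold discrim at h1
  rcases hc.eq_or_lt with h0 | h0
  · rw [← h0]; positivity
  · have : c * (c - a * b) ≤ 0 := by nlinarith
    by_contra hcon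
    push Not at hcon
    nlinarith [mul_pos h0 (sub_pos.2 hcon)]

lemma stepB (m00 m01 m10 m11 : ℂ) (g : ℝ) (hg : 0 < g)
    (h : ∀ y0 y1 z0 z1 : ℂ,
      nq (m00 * y0 * z0 + m01 * y0 * z1 + m10 * y1 * z0 + m11 * y1 * z1) ≤
        g * (nq y0 + nq y1) * (nq z0 + nq z1)) :
    nq m00 + nq m01 + nq m10 + nq m11 ≤ 2 * g ∧
    g * (nq m00 + nq m01 + nq m10 + nq m11) ≤ g ^ 2 + nq (m00 * m11 - m01 * m10) := by
  have hz : ∀ z0 z1 : ℂ, nq (m00 * z0 + m01 * z1) + nq (m10 * z0 + m11 * z1) ≤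
      g * (nq z0 + nq z1) := by
    intro z0 z1
    have h1 := h (star (m00 * z0 + m01 * z1)) (star (m10 * z0 + m11 * z1)) z0 z1
    set u := m00 * z0 + m01 * z1 with hu
    set v := m10 * z0 + m11 * z1 with hv
    have e : m00 * star u * z0 + m01 * star u * z1 + m10 * star v * z0 + m11 * star v * z1
        = ((nq u + nq v : ℝ) : ℂ) := by
      have : ((nq u + nq v : ℝ) : ℂ) = u * star u + v * star v := by
        simp [nq, Complex.mul_conj]
      rw [this]
      linear_combination (-star u) * hu + (-star v) * hv
    rw [e] at h1
    have h2 : nq (star u) = nq u := Complex.normSq_conj u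
    have h3 : nq (star v) = nq v := Complex.normSq_conj v
    have h4 : nq ((nq u + nq v : ℝ) : ℂ) = (nq u + nq v) * (nq u + nq v) := Complex.normSq_ofReal _
    rw [h2, h3, h4] at h1
    have h5 : 0 ≤ nq u + nq v := add_nonneg (Complex.normSq_nonneg _) (Complex.normSq_nonneg _)
    have h6 : 0 ≤ nq z0 + nq z1 := add_nonneg (Complex.normSq_nonneg _) (Complex.normSq_nonneg _)
    rcases h5.eq_or_lt with h7 | h7
    · rw [← h7]; positivity
    · by_contra hcon
      push Not at hcon
      nlinarith [mul_pos h7 (sub_pos.2 hcon)]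
  have hA := hz 1 0
  have hB := hz 0 1
  simp [nq] at hA hB
  refine ⟨by simp only [nq]; linarith, ?_⟩
  set C := star m00 * m01 + star m10 * m11 with hC
  have key := disc_aux (g - (nq m00 + nq m10)) (g - (nq m01 + nq m11)) (nq C) ?_
    (by simp only [nq]; linarith) (by simp only [nq]; linarith) (Complex.normSq_nonneg _)
  · have e : nq (m00 * m11 - m01 * m10) = (nq m00 + nq m10) * (nq m01 + nq m11) - nq C := by
      rw [hC]
      simp [nq, Complex.normSq_apply]
      ring
    rw [e]
    nlinarith
  · intro s
    have h1 := hz 1 (s * star C)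
    have e : nq (m00 * 1 + m01 * (s * star C)) + nq (m10 * 1 + m11 * (s * star C))
        = nq m00 + nq m10 + 2 * s * nq C + s ^ 2 * nq C * (nq m01 + nq m11) := by
      rw [hC]
      simp [nq, Complex.normSq_apply]
      ring
    have e2 : nq (s * star C) = s ^ 2 * nq C := by
      simp [nq, Complex.normSq_apply]; ring
    rw [e, e2] at h1
    simp only [nq, map_one] at h1 ⊢
    nlinarith

lemma stepC (m00 m01 m10 m11 : ℂ) :
    4 * nq (m00 * m11 - m01 * m10) ≤ (nq m00 + nq m01 + nq m10 + nq m11) ^ 2 := by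
  have e : nq (m00 * m11 - m01 * m10) = (nq m00 + nq m10) * (nq m01 + nq m11)
      - nq (star m00 * m01 + star m10 * m11) := by
    simp [nq, Complex.normSq_apply]
    ring
  have := Complex.normSq_nonneg (star m00 * m01 + star m10 * m11)
  rw [e]
  simp only [nq] at *
  nlinarith [sq_nonneg ((Complex.normSq m00 + Complex.normSq m10) - (Complex.normSq m01 + Complex.normSq m11))]

lemma scalar_core (z A G : ℝ) (hz0 : 0 ≤ z) (hz1 : z ≤ 7 / 18) (hA0 : 0 ≤ A) (hG0 : 0 ≤ G)
    (hA : A ≤ (1 / 2 + z) / 2) (hG : G ≤ (1 / 2 - z) / 2)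
    (h : ∀ u : ℝ, 0 ≤ u → u ≤ 1 →
      u * (1 / 2 + z) + (1 - u) * (1 / 2 - z) ≤ 4 / 9 + 9 / 4 * (A * u - G * (1 - u)) ^ 2) :
    z = 1 / 6 ∧ A = 1 / 3 ∧ G = 0 := by
  have hmax : ∀ u : ℝ, 1 / 2 - z ≤ u → u ≤ 1 →
      u * (1 / 2 + z) + (1 - u) * (1 / 2 - z) ≤ 4 / 9 + 9 / 16 * ((1 / 2 + z) * u) ^ 2 := by
    intro u hu hu1
    have h0 : 0 ≤ u := by linarith
    have h1 := h u h0 hu1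
    have h2 : (A * u - G * (1 - u)) ^ 2 ≤ ((1 / 2 + z) * u / 2) ^ 2 := by
      apply sq_le_sq'
      · nlinarith [mul_le_mul_of_nonneg_right hG (sub_nonneg.2 hu1), mul_nonneg hA0 h0]
      · nlinarith [mul_le_mul_of_nonneg_right hA h0, mul_nonneg hG0 (sub_nonneg.2 hu1)]
    nlinarith
  have hT : 0 < (1 / 2 + z) := by linarith
  have hz : z = 1 / 6 := by
    by_cases hc : 1 / 2 - z ≤ 16 * z / (9 * (1 / 2 + z) ^ 2)
    · have h1 := hmax _ hc (by
        rw [div_le_one (by positivity)]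
        nlinarith)
      set u := 16 * z / (9 * (1 / 2 + z) ^ 2) with hu
      have hu2 : u * (1 / 2 + z) ^ 2 = 16 / 9 * z := by
        rw [hu]; field_simp
      have h2 : z - 1 / 18 ≥ z * u := by
        nlinarith
      have h3 : (z - 1 / 18) * (1 / 2 + z) ^ 2 ≥ 16 / 9 * z ^ 2 := by
        nlinarith [mul_le_mul_of_nonneg_right h2 (sq_nonneg (1 / 2 + z))]
      have h4 : (z - 1 / 6) ^ 2 * (1 / 2 - z) ≤ 0 := by nlinarith
      have h5 : (z - 1 / 6) ^ 2 ≤ 0 := by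
        by_contra hcon
        push Not at hcon
        nlinarith [mul_pos hcon (by linarith : 0 < 1 / 2 - z)]
      nlinarith [pow_eq_zero_iff (two_ne_zero) |>.1 (le_antisymm h5 (sq_nonneg _))]
    · exfalso
      push Not at hc
      rw [div_lt_iff₀ (by positivity)] at hc
      have hzs : z < 9 / 110 := by
        by_contra hcon
        push Not at hcon
        nlinarith [mul_nonneg (sq_nonneg z) hT.le]
      have h1 := hmax (1 / 2 - z) le_rfl (by linarith)
      nlinarith [sq_nonneg z, sq_nonneg (z^2), mul_nonneg hz0 (sub_nonneg.2 hzs.le)]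
  subst hz
  have h1 := h (2 / 3) (by norm_num) (by norm_num)
  have h2 : 2 / 3 ≤ 2 * A - G := by
    by_contra hcon
    push Not at hcon
    nlinarith
  refine ⟨rfl, by linarith, by linarith⟩

lemma takagi (A B C : ℂ) : ∃ p q : ℂ, nq p + nq q = 1 ∧
    -2 * A * p * star q + B * (p * star p - q * star q) + 2 * C * q * star p = 0 := by
  obtain ⟨X, Y, Z, hne, hZ, h1, h2⟩ : ∃ X Y Z : ℝ, 0 < X ^ 2 + Y ^ 2 + Z ^ 2 ∧ 0 ≤ Z ∧
      B.re * Z + X * (C - A).re - Y * (A + C).im = 0 ∧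
      B.im * Z + X * (C - A).im + Y * (A + C).re = 0 := by
    obtain ⟨v, hv0, hv⟩ : ∃ v : Fin 3 → ℝ,
        Matrix.mulVec !![(C - A).re, -(A + C).im, B.re; (C - A).im, (A + C).re, B.im] v = 0 ∧
          v ≠ 0 := by
      have := LinearMap.ker_ne_bot_of_finrank_lt (f := Matrix.mulVecLin
        !![(C - A).re, -(A + C).im, B.re; (C - A).im, (A + C).re, B.im]) (by simp)
      obtain ⟨v, hv, hv0⟩ := (Submodule.ne_bot_iff _).1 this
      exact ⟨v, by simpa using hv, hv0⟩
    have e0 := congrFun hv0 0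
    have e1 := congrFun hv0 1
    simp [Matrix.mulVec, dotProduct, Fin.sum_univ_three] at e0 e1
    have hpos : 0 < v 0 ^ 2 + v 1 ^ 2 + v 2 ^ 2 := by
      by_contra hcon
      apply hv
      have a0 : v 0 = 0 := by nlinarith [sq_nonneg (v 0), sq_nonneg (v 1), sq_nonneg (v 2)]
      have a1 : v 1 = 0 := by nlinarith [sq_nonneg (v 0), sq_nonneg (v 1), sq_nonneg (v 2)]
      have a2 : v 2 = 0 := by nlinarith [sq_nonneg (v 0), sq_nonneg (v 1), sq_nonneg (v 2)]
      funext i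
      fin_cases i <;> simp [a0, a1, a2]
    rcases le_total 0 (v 2) with h | h
    · refine ⟨v 0, v 1, v 2, hpos, h, ?_, ?_⟩ <;> simp <;> linarith
    · refine ⟨-v 0, -v 1, -v 2, by nlinarith, by linarith, ?_, ?_⟩ <;> simp <;> linarith
  set r := Real.sqrt (X ^ 2 + Y ^ 2 + Z ^ 2) with hr
  have hr0 : 0 < r := Real.sqrt_pos.2 hne
  have hr2 : r ^ 2 = X ^ 2 + Y ^ 2 + Z ^ 2 := Real.sq_sqrt hne.le
  set n := Real.sqrt (2 * r * (r + Z)) with hn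
  have hn0 : 0 < n := Real.sqrt_pos.2 (by positivity)
  have hn2 : n ^ 2 = 2 * r * (r + Z) := Real.sq_sqrt (by positivity)
  have hE : B * Z + X * (C - A) + Complex.I * Y * (A + C) = 0 := by
    apply Complex.ext
    · simp at h1 ⊢; linarith
    · simp at h2 ⊢; linarith
  refine ⟨((r + Z) / n : ℝ), (X + Y * Complex.I) / n, ?_, ?_⟩
  · have e1 : nq (((r + Z) / n : ℝ) : ℂ) = (r + Z) ^ 2 / n ^ 2 := by
      rw [nq, Complex.normSq_ofReal]; ring
    have e2 : nq ((X + Y * Complex.I) / n) = (X ^ 2 + Y ^ 2) / n ^ 2 := by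
      rw [nq, Complex.normSq_div, Complex.normSq_ofReal, Complex.normSq_add_mul_I]; ring
    rw [e1, e2, ← add_div, div_eq_one_iff_eq (by positivity), hn2]
    nlinarith
  · have hnc : (n : ℂ) ≠ 0 := by exact_mod_cast hn0.ne'
    have hrc : (r : ℂ) ^ 2 = X ^ 2 + Y ^ 2 + Z ^ 2 := by exact_mod_cast hr2
    have s1 : star ((((r + Z) / n : ℝ)) : ℂ) = (((r + Z) / n : ℝ) : ℂ) := Complex.conj_ofReal _
    have s2 : star (((X : ℂ) + Y * Complex.I) / n) = (X - Y * Complex.I) / n := by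
      simp [sub_eq_add_neg]
    rw [s1, s2]
    push_cast
    field_simp
    linear_combination 2 * ((r : ℂ) + Z) * hE + B * hrc + B * Y ^ 2 * Complex.I_sq

lemma phase_align (α γ : ℂ) : ∃ ζ : ℂ, nq ζ = 1 ∧
    ∀ u v : ℝ, nq (α * u + γ * ζ ^ 2 * v) = (‖α‖ * u - ‖γ‖ * v) ^ 2 := by
  refine ⟨Complex.exp (((α.arg - γ.arg + Real.pi) / 2 : ℝ) * Complex.I), ?_, ?_⟩
  · rw [nq, Complex.normSq_eq_norm_sq, Complex.norm_exp_ofReal_mul_I]; norm_num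
  · intro u v
    have hz : Complex.exp (γ.arg * Complex.I) *
        Complex.exp (((α.arg - γ.arg + Real.pi) / 2 : ℝ) * Complex.I) ^ 2
        = - Complex.exp (α.arg * Complex.I) := by
      rw [← Complex.exp_nat_mul, ← Complex.exp_add]
      have : (γ.arg : ℂ) * Complex.I + ((2 : ℕ) : ℂ) * (((α.arg - γ.arg + Real.pi) / 2 : ℝ) * Complex.I)
          = α.arg * Complex.I + Real.pi * Complex.I := by
        push_cast; ring
      rw [this, Complex.exp_add, Complex.exp_pi_mul_I]
      ring
    have hα := Complex.norm_mul_exp_arg_mul_I α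
    have hγ := Complex.norm_mul_exp_arg_mul_I γ
    set w := Complex.exp (((α.arg - γ.arg + Real.pi) / 2 : ℝ) * Complex.I)
    have : α * u + γ * w ^ 2 * v
        = ((‖α‖ * u - ‖γ‖ * v : ℝ) : ℂ) * Complex.exp (α.arg * Complex.I) := by
      push_cast
      linear_combination (-u) * hα - w ^ 2 * v * hγ + ‖γ‖ * v * hz
    rw [this, nq, Complex.normSq_mul, Complex.normSq_ofReal, Complex.normSq_eq_norm_sq (Complex.exp _),
      Complex.norm_exp_ofReal_mul_I]
    ring


lemma unit_struct (m00 m01 m10 m11 : ℂ)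
    (h : 4 * nq (m00 * m11 - m01 * m10) = (nq m00 + nq m01 + nq m10 + nq m11) ^ 2) :
    nq m00 + nq m10 = nq m01 + nq m11 ∧ star m00 * m01 + star m10 * m11 = 0 := by
  have e : nq (m00 * m11 - m01 * m10) = (nq m00 + nq m10) * (nq m01 + nq m11)
      - nq (star m00 * m01 + star m10 * m11) := by
    simp [nq, Complex.normSq_apply]
    ring
  have h0 := Complex.normSq_nonneg (star m00 * m01 + star m10 * m11)
  rw [e] at h
  set P := nq m00 + nq m10 with hP
  set Q := nq m01 + nq m11 with hQ
  have hs : nq m00 + nq m01 + nq m10 + nq m11 = P + Q := by rw [hP, hQ]; ring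
  rw [hs] at h
  simp only [nq] at h
  have h1 : Complex.normSq (star m00 * m01 + star m10 * m11) = 0 := by
    nlinarith [sq_nonneg (P - Q)]
  refine ⟨?_, Complex.normSq_eq_zero.1 h1⟩
  have : (P - Q) ^ 2 = 0 := by nlinarith [sq_nonneg (P - Q)]
  have := pow_eq_zero_iff (two_ne_zero) |>.1 this
  linarith

lemma nq_c (z : ℂ) : ((nq z : ℝ) : ℂ) = z * star z := (Complex.mul_conj z).symm

lemma rank_one (v00 v01 v10 v11 : ℂ) (hd : v00 * v11 - v01 * v10 = 0)
    (hn : nq v00 + nq v01 + nq v10 + nq v11 = 1) :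
    ∃ b0 b1 c0 c1 : ℂ, nq b0 + nq b1 = 1 ∧ nq c0 + nq c1 = 1 ∧
      v00 = b0 * c0 ∧ v01 = b0 * c1 ∧ v10 = b1 * c0 ∧ v11 = b1 * c1 := by
  have p00 := Complex.normSq_nonneg v00
  have p01 := Complex.normSq_nonneg v01
  by_cases h0 : nq v00 + nq v01 = 0
  · simp only [nq] at h0 hn
    have z0 : v00 = 0 := Complex.normSq_eq_zero.1 (by linarith)
    have z1 : v01 = 0 := Complex.normSq_eq_zero.1 (by linarith)
    refine ⟨0, 1, v10, v11, by simp, ?_, ?_⟩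
    · simp only [nq]; linarith
    · simp [z0, z1]
  · have hpos : 0 < nq v00 + nq v01 := lt_of_le_of_ne (add_nonneg p00 p01) (Ne.symm h0)
    set r := Real.sqrt (nq v00 + nq v01) with hr
    have hr0 : 0 < r := Real.sqrt_pos.2 hpos
    have hr2 : r ^ 2 = nq v00 + nq v01 := Real.sq_sqrt hpos.le
    have hrc : (r : ℂ) ≠ 0 := by exact_mod_cast hr0.ne'
    have hr2c : (r : ℂ) ^ 2 = v00 * star v00 + v01 * star v01 := by
      rw [← nq_c, ← nq_c]; exact_mod_cast hr2
    have E : v00 = r * (v00 / r) ∧ v01 = r * (v01 / r) ∧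
       v10 = ((v10 * star v00 + v11 * star v01) / r) * (v00 / r) ∧
       v11 = ((v10 * star v00 + v11 * star v01) / r) * (v01 / r) := by
      refine ⟨by field_simp, by field_simp, ?_, ?_⟩
      · field_simp
        linear_combination v10 * hr2c - star v01 * hd
      · field_simp
        linear_combination v11 * hr2c + star v00 * hd
    have hc : nq (v00 / r) + nq (v01 / r) = 1 := by
      simp only [nq, Complex.normSq_div, Complex.normSq_ofReal]
      rw [← add_div, div_eq_one_iff_eq (by positivity)]
      simp only [nq] at hr2
      nlinarith
    refine ⟨r, (v10 * star v00 + v11 * star v01) / r, v00 / r, v01 / r, ?_, hc, E⟩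
    obtain ⟨e1, e2, e3, e4⟩ := E
    have f1 := congrArg nq e1
    have f2 := congrArg nq e2
    have f3 := congrArg nq e3
    have f4 := congrArg nq e4
    simp only [nq, Complex.normSq_mul] at f1 f2 f3 f4 hc hn ⊢
    have : (Complex.normSq (r : ℂ) + Complex.normSq ((v10 * star v00 + v11 * star v01) / r)) *
      (Complex.normSq (v00 / r) + Complex.normSq (v01 / r)) = 1 := by linarith
    rw [hc, mul_one] at this
    exact this

/-- orthonormal pair in `ℂ²` -/
def ONP (a0 a1 : Fin 2 → ℂ) : Prop :=
  (a0 0 * star (a0 0) + a0 1 * star (a0 1) = 1) ∧ (a1 0 * star (a1 0) + a1 1 * star (a1 1) = 1) ∧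
  (star (a0 0) * a1 0 + star (a0 1) * a1 1 = 0)

lemma onp_complete (b0 b1 d0 d1 : ℂ) (h1 : b0 * star b0 + b1 * star b1 = 1)
    (h2 : d0 * star d0 + d1 * star d1 = 1) (h3 : star b0 * d0 + star b1 * d1 = 0) :
    b0 * star b0 + d0 * star d0 = 1 ∧ b1 * star b1 + d1 * star d1 = 1 ∧
    b0 * star b1 + d0 * star d1 = 0 ∧ b1 * star b0 + d1 * star d0 = 0 := by
  have h3' : b0 * star d0 + b1 * star d1 = 0 := by
    have := congrArg star h3
    simpa [mul_comm] using this
  have : !![star b0, star b1; star d0, star d1] * !![b0, d0; b1, d1] = 1 := by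
    rw [Matrix.one_fin_two, Matrix.mul_fin_two]
    congr! 4
    · linear_combination h1
    · congr! 1
      linear_combination h3'
    · congr! 1
      linear_combination h2
  have := mul_eq_one_comm.1 this
  rw [Matrix.one_fin_two, Matrix.mul_fin_two] at this
  have a := congrFun (congrFun this 0) 0
  have b := congrFun (congrFun this 0) 1
  have c := congrFun (congrFun this 1) 0
  have d := congrFun (congrFun this 1) 1
  simp at a b c d
  exact ⟨a, d, b, c⟩

lemma UV_struct (u00 u01 u10 u11 v00 v01 v10 v11 : ℂ)
    (hc0 : u00 * star u00 + u10 * star u10 = 1) (hc1 : u01 * star u01 + u11 * star u11 = 1)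
    (hc : star u00 * u01 + star u10 * u11 = 0)
    (hd : v00 * v11 - v01 * v10 = 0)
    (hn : nq v00 + nq v01 + nq v10 + nq v11 = 1)
    (ho : u00 * star v00 + u01 * star v01 + u10 * star v10 + u11 * star v11 = 0) :
    ∃ b0 b1 c0 c1 : Fin 2 → ℂ, ONP b0 b1 ∧ ONP c0 c1 ∧
      (v00 = b0 0 * c0 0 ∧ v01 = b0 0 * c0 1 ∧ v10 = b0 1 * c0 0 ∧ v11 = b0 1 * c0 1) ∧
      (u00 = b0 0 * c1 0 + b1 0 * c0 0 ∧ u01 = b0 0 * c1 1 + b1 0 * c0 1 ∧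
       u10 = b0 1 * c1 0 + b1 1 * c0 0 ∧ u11 = b0 1 * c1 1 + b1 1 * c0 1) := by
  obtain ⟨b0, b1, c0, c1, hb, hcc, e1, e2, e3, e4⟩ := rank_one v00 v01 v10 v11 hd hn
  have hb' : b0 * star b0 + b1 * star b1 = 1 := by
    rw [← nq_c, ← nq_c]; exact_mod_cast hb
  have hcc' : c0 * star c0 + c1 * star c1 = 1 := by
    rw [← nq_c, ← nq_c]; exact_mod_cast hcc
  have hcs : u00 * star u01 + u10 * star u11 = 0 := by
    have := congrArg star hc
    simpa [mul_comm] using this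
  obtain ⟨hr0, hr1, hr, hr'⟩ := onp_complete u00 u10 u01 u11 hc0 hc1 hc
  have ho' : star b0 * (u00 * star c0 + u01 * star c1) + star b1 * (u10 * star c0 + u11 * star c1) = 0 := by
    rw [e1, e2, e3, e4] at ho
    simp only [star_mul'] at ho
    linear_combination ho
  have hb1 : (u00 * star c0 + u01 * star c1) * star (u00 * star c0 + u01 * star c1) +
      (u10 * star c0 + u11 * star c1) * star (u10 * star c0 + u11 * star c1) = 1 := by
    simp only [star_add, star_mul', star_star]
    linear_combination hcc' + c0 * star c0 * hc0 + c1 * star c1 * hc1 + c1 * star c0 * hcs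
      + c0 * star c1 * hc
  obtain ⟨g0, g1, g2, g3⟩ := onp_complete b0 b1 _ _ hb' hb1 ho'
  simp only [star_add, star_mul', star_star] at g0 g1 g2 g3
  have k0 : (star u00 * c0 + star u01 * c1) * u00 + (star u10 * c0 + star u11 * c1) * u10 = c0 := by
    linear_combination c0 * hc0 + c1 * hcs
  have k1 : (star u00 * c0 + star u01 * c1) * u01 + (star u10 * c0 + star u11 * c1) * u11 = c1 := by
    linear_combination c1 * hc1 + c0 * hc
  refine ⟨![b0, b1], ![u00 * star c0 + u01 * star c1, u10 * star c0 + u11 * star c1], ![c0, c1],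
    ![star b0 * u00 + star b1 * u10, star b0 * u01 + star b1 * u11],
    ⟨by simpa using hb', by simpa using hb1, by simpa using ho'⟩, ⟨by simpa using hcc', ?_, ?_⟩,
    ⟨e1, e2, e3, e4⟩, ?_, ?_, ?_, ?_⟩
  · simp only [Matrix.cons_val_zero, Matrix.cons_val_one, star_add, star_mul', star_star]
    linear_combination hb' + b0 * star b0 * hr0 + b1 * star b1 * hr1 + b1 * star b0 * hr + b0 * star b1 * hr'
  · simp only [Matrix.cons_val_zero, Matrix.cons_val_one]
    linear_combination ho'
  · simp only [Matrix.cons_val_zero, Matrix.cons_val_one]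
    linear_combination (-u00) * g0 - u10 * g2 + (u00 * star c0 + u01 * star c1) * k0
  · simp only [Matrix.cons_val_zero, Matrix.cons_val_one]
    linear_combination (-u01) * g0 - u11 * g2 + (u00 * star c0 + u01 * star c1) * k1
  · simp only [Matrix.cons_val_zero, Matrix.cons_val_one]
    linear_combination (-u10) * g1 - u00 * g3 + (u10 * star c0 + u11 * star c1) * k0
  · simp only [Matrix.cons_val_zero, Matrix.cons_val_one]
    linear_combination (-u11) * g1 - u01 * g3 + (u10 * star c0 + u11 * star c1) * k1

lemma core_s4 (m00 m01 m10 m11 n00 n01 n10 n11 : ℂ)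
    (hT : nq m00 + nq m01 + nq m10 + nq m11 + (nq n00 + nq n01 + nq n10 + nq n11) = 1)
    (hβ : m00 * n11 + m11 * n00 - m01 * n10 - m10 * n01 = 0)
    (h : ∀ s t y0 y1 z0 z1 : ℂ,
      nq ((s * m00 + t * n00) * y0 * z0 + (s * m01 + t * n01) * y0 * z1
        + (s * m10 + t * n10) * y1 * z0 + (s * m11 + t * n11) * y1 * z1) ≤
        4 / 9 * (nq s + nq t) * (nq y0 + nq y1) * (nq z0 + nq z1))
    (hle : nq n00 + nq n01 + nq n10 + nq n11 ≤ nq m00 + nq m01 + nq m10 + nq m11) :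
    ∃ b0 b1 c0 c1 : Fin 2 → ℂ, ONP b0 b1 ∧ ONP c0 c1 ∧
      (Real.sqrt 3 * n00 = b0 0 * c0 0 ∧ Real.sqrt 3 * n01 = b0 0 * c0 1 ∧
       Real.sqrt 3 * n10 = b0 1 * c0 0 ∧ Real.sqrt 3 * n11 = b0 1 * c0 1) ∧
      (Real.sqrt 3 * m00 = b0 0 * c1 0 + b1 0 * c0 0 ∧ Real.sqrt 3 * m01 = b0 0 * c1 1 + b1 0 * c0 1 ∧
       Real.sqrt 3 * m10 = b0 1 * c1 0 + b1 1 * c0 0 ∧ Real.sqrt 3 * m11 = b0 1 * c1 1 + b1 1 * c0 1) := by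
  set α := m00 * m11 - m01 * m10 with hα
  set γ := n00 * n11 - n01 * n10 with hγ
  have hst : ∀ s t : ℂ, nq s + nq t = 1 →
      nq s * (nq m00 + nq m01 + nq m10 + nq m11) + nq t * (nq n00 + nq n01 + nq n10 + nq n11)
        ≤ 4 / 9 + 9 / 4 * nq (α * s ^ 2 + γ * t ^ 2) := by
    intro s t hs
    have a1 := (stepB _ _ _ _ (4 / 9) (by norm_num) (fun y0 y1 z0 z1 => by
      have := h s t y0 y1 z0 z1
      rwa [hs, mul_one] at this)).2
    have a2 := (stepB _ _ _ _ (4 / 9) (by norm_num) (fun y0 y1 z0 z1 => by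
      have := h s (-t) y0 y1 z0 z1
      rwa [show nq (-t) = nq t from Complex.normSq_neg t, hs, mul_one] at this)).2
    have d1 : (s * m00 + t * n00) * (s * m11 + t * n11) - (s * m01 + t * n01) * (s * m10 + t * n10)
        = α * s ^ 2 + γ * t ^ 2 := by
      rw [hα, hγ]; linear_combination s * t * hβ
    have d2 : (s * m00 + -t * n00) * (s * m11 + -t * n11) - (s * m01 + -t * n01) * (s * m10 + -t * n10)
        = α * s ^ 2 + γ * t ^ 2 := by
      rw [hα, hγ]; linear_combination -s * t * hβ
    rw [d1] at a1
    rw [d2] at a2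
    have par : ∀ m n : ℂ, nq (s * m + t * n) + nq (s * m + -t * n) = 2 * (nq s * nq m + nq t * nq n) := by
      intro m n
      simp [nq, Complex.normSq_apply]; ring
    have p00 := par m00 n00
    have p01 := par m01 n01
    have p10 := par m10 n10
    have p11 := par m11 n11
    linarith
  have hM2 := (stepB m00 m01 m10 m11 (4 / 9) (by norm_num) (fun y0 y1 z0 z1 => by
      have := h 1 0 y0 y1 z0 z1
      simpa using this)).1
  have cM := stepC m00 m01 m10 m11
  have cN := stepC n00 n01 n10 n11
  rw [← hα] at cM
  rw [← hγ] at cN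
  set TM := nq m00 + nq m01 + nq m10 + nq m11 with hTM
  set TN := nq n00 + nq n01 + nq n10 + nq n11 with hTN
  have hTN0 : 0 ≤ TN := by
    have := Complex.normSq_nonneg n00
    have := Complex.normSq_nonneg n01
    have := Complex.normSq_nonneg n10
    have := Complex.normSq_nonneg n11
    simp only [hTN, nq]; linarith
  have na : nq α = ‖α‖ ^ 2 := Complex.normSq_eq_norm_sq α
  have ng : nq γ = ‖γ‖ ^ 2 := Complex.normSq_eq_norm_sq γ
  obtain ⟨ζ, hζ, hal⟩ := phase_align α γ
  have sc := scalar_core (TM - 1 / 2) ‖α‖ ‖γ‖ (by linarith) (by linarith) (norm_nonneg _) (norm_nonneg _)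
    (by
      have : 2 * ‖α‖ ≤ TM := abs_le_of_sq_le_sq' (by linarith) (by linarith) |>.2
      linarith)
    (by
      have : 2 * ‖γ‖ ≤ TN := abs_le_of_sq_le_sq' (by linarith) (by linarith) |>.2
      linarith)
    (by
      intro u hu hu1
      have q1 : nq (Real.sqrt u : ℂ) = u := by
        rw [nq, Complex.normSq_ofReal, Real.mul_self_sqrt hu]
      have q2 : nq ((Real.sqrt (1 - u) : ℂ) * ζ) = 1 - u := by
        rw [nq, Complex.normSq_mul, Complex.normSq_ofReal, Real.mul_self_sqrt (by linarith)]
        simp only [nq] at hζ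
        rw [hζ, mul_one]
      have := hst (Real.sqrt u) (Real.sqrt (1 - u) * ζ) (by rw [q1, q2]; ring)
      have e : α * (Real.sqrt u : ℂ) ^ 2 + γ * (Real.sqrt (1 - u) * ζ) ^ 2
          = α * (u : ℝ) + γ * ζ ^ 2 * ((1 - u : ℝ) : ℂ) := by
        have r1 : (Real.sqrt u : ℂ) ^ 2 = (u : ℝ) := by exact_mod_cast Real.sq_sqrt hu
        have r2 : (Real.sqrt (1 - u) : ℂ) ^ 2 = ((1 - u : ℝ) : ℂ) := by
          exact_mod_cast Real.sq_sqrt (by linarith : 0 ≤ 1 - u)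
        rw [mul_pow, r1, r2]; ring
      rw [e, hal, q1, q2] at this
      have hTN' : TN = 1 - TM := by linarith
      rw [hTN'] at this
      nlinarith)
  obtain ⟨s1, s2, s3⟩ := sc
  have tM : TM = 2 / 3 := by linarith
  have tN : TN = 1 / 3 := by linarith
  have g0 : γ = 0 := norm_eq_zero.1 s3
  have a0 : α ≠ 0 := by
    intro h0
    rw [h0, norm_zero] at s2
    norm_num at s2
  obtain ⟨us1, us2⟩ := unit_struct m00 m01 m10 m11 (by
    rw [← hα, na, s2, ← hTM, tM]; norm_num)
  have c0 : nq m00 + nq m10 = 1 / 3 := by linarith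
  have c1 : nq m01 + nq m11 = 1 / 3 := by linarith
  have c0' : m00 * star m00 + m10 * star m10 = 1 / 3 := by
    rw [← nq_c, ← nq_c]
    have := congrArg (fun x : ℝ => (x : ℂ)) c0
    push_cast at this ⊢
    exact this
  have c1' : m01 * star m01 + m11 * star m11 = 1 / 3 := by
    rw [← nq_c, ← nq_c]
    have := congrArg (fun x : ℝ => (x : ℂ)) c1
    push_cast at this ⊢
    exact this
  have us2' : m00 * star m01 + m10 * star m11 = 0 := by
    have := congrArg star us2
    simpa [mul_comm] using this
  have o : star m00 * n00 + star m01 * n01 + star m10 * n10 + star m11 * n11 = 0 := by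
    have : α * (star m00 * n00 + star m01 * n01 + star m10 * n10 + star m11 * n11) = 0 := by
      have k1 : α * star m00 = m11 / 3 := by
        rw [hα]; linear_combination m11 * c0' - m10 * us2
      have k2 : α * star m01 = - m10 / 3 := by
        rw [hα]; linear_combination m11 * us2' - m10 * c1'
      have k3 : α * star m10 = - m01 / 3 := by
        rw [hα]; linear_combination m00 * us2 - m01 * c0'
      have k4 : α * star m11 = m00 / 3 := by
        rw [hα]; linear_combination m00 * c1' - m01 * us2'
      linear_combination n00 * k1 + n01 * k2 + n10 * k3 + n11 * k4 + hβ / 3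
    exact (mul_eq_zero.1 this).resolve_left a0
  have o' : m00 * star n00 + m01 * star n01 + m10 * star n10 + m11 * star n11 = 0 := by
    have := congrArg star o
    simpa [mul_comm] using this
  have h3 : (Real.sqrt 3 : ℂ) * Real.sqrt 3 = 3 := by
    exact_mod_cast Real.mul_self_sqrt (by norm_num : (0:ℝ) ≤ 3)
  have hs3 : star (Real.sqrt 3 : ℂ) = Real.sqrt 3 := Complex.conj_ofReal _
  have n3 : nq (Real.sqrt 3 : ℂ) = 3 := by
    rw [nq, Complex.normSq_ofReal]; exact Real.mul_self_sqrt (by norm_num : (0:ℝ) ≤ 3)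
  apply UV_struct
  · simp only [star_mul', hs3]
    linear_combination 3 * c0' + (m00 * star m00 + m10 * star m10) * h3
  · simp only [star_mul', hs3]
    linear_combination 3 * c1' + (m01 * star m01 + m11 * star m11) * h3
  · simp only [star_mul', hs3]
    linear_combination (Real.sqrt 3) ^ 2 * us2
  · have : n00 * n11 - n01 * n10 = 0 := by rw [← hγ]; exact g0
    linear_combination (Real.sqrt 3) ^ 2 * this
  · simp only [nq, Complex.normSq_mul] at n3 hTN ⊢
    rw [n3]; linarith
  · simp only [star_mul', hs3]
    linear_combination (Real.sqrt 3) ^ 2 * o'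

/-- squared norm of a qubit vector -/
def n2 (x : Fin 2 → ℂ) : ℝ := nq (x 0) + nq (x 1)

theorem W_unique (ψ : Fin 2 → Fin 2 → Fin 2 → ℂ) (h1 : ∑ i, ∑ j, ∑ k, nq (ψ i j k) = 1)
    (h : ∀ x y z : Fin 2 → ℂ, nq (∑ i, ∑ j, ∑ k, ψ i j k * (x i * y j * z k)) ≤
      4 / 9 * (n2 x * n2 y * n2 z)) :
    ∃ a0 a1 b0 b1 c0 c1 : Fin 2 → ℂ, ONP a0 a1 ∧ ONP b0 b1 ∧ ONP c0 c1 ∧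
      ∀ i j k, Real.sqrt 3 * ψ i j k = a1 i * b0 j * c0 k + a0 i * b1 j * c0 k + a0 i * b0 j * c1 k := by
  obtain ⟨p, q, hpq, hb⟩ := takagi (ψ 0 0 0 * ψ 0 1 1 - ψ 0 0 1 * ψ 0 1 0)
    (ψ 0 0 0 * ψ 1 1 1 + ψ 0 1 1 * ψ 1 0 0 - ψ 0 0 1 * ψ 1 1 0 - ψ 0 1 0 * ψ 1 0 1)
    (ψ 1 0 0 * ψ 1 1 1 - ψ 1 0 1 * ψ 1 1 0)
  have hpq' : p * star p + q * star q = 1 := by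
    rw [← nq_c, ← nq_c]; exact_mod_cast hpq
  set M : Fin 2 → Fin 2 → ℂ := fun j k => p * ψ 0 j k + q * ψ 1 j k with hM
  set N : Fin 2 → Fin 2 → ℂ := fun j k => -star q * ψ 0 j k + star p * ψ 1 j k with hN
  have inv0 : ∀ j k, ψ 0 j k = star p * M j k - q * N j k := by
    intro j k; simp only [hM, hN]; linear_combination (-ψ 0 j k) * hpq'
  have inv1 : ∀ j k, ψ 1 j k = star q * M j k + p * N j k := by
    intro j k; simp only [hM, hN]; linear_combination (-ψ 1 j k) * hpq'
  have hnorm : ∀ j k, nq (M j k) + nq (N j k) = nq (ψ 0 j k) + nq (ψ 1 j k) := by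
    intro j k
    have : nq (M j k) + nq (N j k) = (nq p + nq q) * (nq (ψ 0 j k) + nq (ψ 1 j k)) := by
      simp [hM, hN, nq, Complex.normSq_apply]; ring
    rw [this, hpq, one_mul]
  have hβ : M 0 0 * N 1 1 + M 1 1 * N 0 0 - M 0 1 * N 1 0 - M 1 0 * N 0 1 = 0 := by
    simp only [hM, hN]
    linear_combination hb
  simp only [Fin.sum_univ_two] at h1 h
  have hT : nq (M 0 0) + nq (M 0 1) + nq (M 1 0) + nq (M 1 1) +
      (nq (N 0 0) + nq (N 0 1) + nq (N 1 0) + nq (N 1 1)) = 1 := by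
    linarith [hnorm 0 0, hnorm 0 1, hnorm 1 0, hnorm 1 1]
  have hh : ∀ s t y0 y1 z0 z1 : ℂ,
      nq ((s * M 0 0 + t * N 0 0) * y0 * z0 + (s * M 0 1 + t * N 0 1) * y0 * z1
        + (s * M 1 0 + t * N 1 0) * y1 * z0 + (s * M 1 1 + t * N 1 1) * y1 * z1) ≤
        4 / 9 * (nq s + nq t) * (nq y0 + nq y1) * (nq z0 + nq z1) := by
    intro s t y0 y1 z0 z1
    have := h ![s * p - t * star q, s * q + t * star p] ![y0, y1] ![z0, z1]
    have e : n2 ![s * p - t * star q, s * q + t * star p] = nq s + nq t := by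
      have : n2 ![s * p - t * star q, s * q + t * star p] = (nq s + nq t) * (nq p + nq q) := by
        simp [n2, nq, Complex.normSq_apply]; ring
      rw [this, hpq, mul_one]
    rw [e] at this
    simp only [n2, Matrix.cons_val_zero, Matrix.cons_val_one] at this
    convert this using 1
    · congr 1
      simp only [hM, hN]
      ring
    · ring
  rcases le_total (nq (N 0 0) + nq (N 0 1) + nq (N 1 0) + nq (N 1 1))
    (nq (M 0 0) + nq (M 0 1) + nq (M 1 0) + nq (M 1 1)) with hle | hle
  · obtain ⟨b0, b1, c0, c1, hb, hc, ⟨v0, v1, v2, v3⟩, w0, w1, w2, w3⟩ :=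
      core_s4 _ _ _ _ _ _ _ _ hT hβ hh hle
    refine ⟨![star p, star q], ![-q, p], b0, b1, c0, c1, ⟨?_, ?_, ?_⟩, hb, hc, ?_⟩
    · simp [-RCLike.star_def, -Complex.star_def]; linear_combination hpq'
    · simp [-RCLike.star_def, -Complex.star_def]; linear_combination hpq'
    · simp [-RCLike.star_def, -Complex.star_def]; ring
    · intro i j k
      fin_cases i
      · simp only [Fin.zero_eta, Matrix.cons_val_zero, inv0]
        fin_cases j <;> fin_cases k <;> simp [-RCLike.star_def, -Complex.star_def]
        · linear_combination star p * w0 - q * v0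
        · linear_combination star p * w1 - q * v1
        · linear_combination star p * w2 - q * v2
        · linear_combination star p * w3 - q * v3
      · simp only [Fin.mk_one, Matrix.cons_val_one, inv1]
        fin_cases j <;> fin_cases k <;> simp [-RCLike.star_def, -Complex.star_def]
        · linear_combination star q * w0 + p * v0
        · linear_combination star q * w1 + p * v1
        · linear_combination star q * w2 + p * v2
        · linear_combination star q * w3 + p * v3
  · obtain ⟨b0, b1, c0, c1, hb, hc, ⟨v0, v1, v2, v3⟩, w0, w1, w2, w3⟩ :=
      core_s4 (N 0 0) (N 0 1) (N 1 0) (N 1 1) (M 0 0) (M 0 1) (M 1 0) (M 1 1) (by linarith)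
        (by linear_combination hβ)
        (by
          intro s t y0 y1 z0 z1
          have := hh t s y0 y1 z0 z1
          rw [add_comm (nq t)] at this
          convert this using 2
          ring) hle
    refine ⟨![-q, p], ![star p, star q], b0, b1, c0, c1, ⟨?_, ?_, ?_⟩, hb, hc, ?_⟩
    · simp [-RCLike.star_def, -Complex.star_def]; linear_combination hpq'
    · simp [-RCLike.star_def, -Complex.star_def]; linear_combination hpq'
    · simp [-RCLike.star_def, -Complex.star_def]; ring
    · intro i j k
      fin_cases i
      · simp only [Fin.zero_eta, Matrix.cons_val_zero, inv0]
        fin_cases j <;> fin_cases k <;> simp [-RCLike.star_def, -Complex.star_def]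
        · linear_combination star p * v0 - q * w0
        · linear_combination star p * v1 - q * w1
        · linear_combination star p * v2 - q * w2
        · linear_combination star p * v3 - q * w3
      · simp only [Fin.mk_one, Matrix.cons_val_one, inv1]
        fin_cases j <;> fin_cases k <;> simp [-RCLike.star_def, -Complex.star_def]
        · linear_combination star q * v0 + p * w0
        · linear_combination star q * v1 + p * w1
        · linear_combination star q * v2 + p * w2
        · linear_combination star q * v3 + p * w3

/-- index set of three qubits -/
abbrev Q3 := Fin 3 → Fin 2

lemma sum3 {M : Type*} [AddCommMonoid M] (g : Q3 → M) :
    ∑ f, g f = ∑ i, ∑ j, ∑ k, g ![i, j, k] := by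
  let e : (Fin 2 × Fin 2 × Fin 2) ≃ Q3 :=
    { toFun := fun p => ![p.1, p.2.1, p.2.2]
      invFun := fun f => (f 0, f 1, f 2)
      left_inv := fun p => rfl
      right_inv := fun f => by funext i; fin_cases i <;> rfl }
  rw [← e.sum_comp, Fintype.sum_prod_type]
  refine Finset.sum_congr rfl fun i _ => ?_
  rw [Fintype.sum_prod_type]
  rfl

/-- product vector -/
def tp (a b c : Fin 2 → ℂ) : Q3 → ℂ := fun f => a (f 0) * b (f 1) * c (f 2)

/-- squared norm -/
def vsq (v : Q3 → ℂ) : ℝ := ∑ f, nq (v f)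

lemma vsq_nonneg (v : Q3 → ℂ) : 0 ≤ vsq v := Finset.sum_nonneg fun _ _ => Complex.normSq_nonneg _

lemma vsq_smul (c : ℂ) (v : Q3 → ℂ) : vsq (c • v) = nq c * vsq v := by
  simp [vsq, nq, Finset.mul_sum]

lemma vsq_tp (a b c : Fin 2 → ℂ) : vsq (tp a b c) = n2 a * n2 b * n2 c := by
  simp [vsq, sum3, tp, n2, nq, Fin.sum_univ_two]
  ring

lemma isProdVec_iff (v : Q3 → ℂ) :
    IsProdVec (Idx := fun _ : Fin 3 => Fin 2) v ↔ ∃ a b c, v = tp a b c := by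
  constructor
  · rintro ⟨ψ, h⟩
    refine ⟨ψ 0, ψ 1, ψ 2, ?_⟩
    funext f
    rw [h, Fin.prod_univ_three]; rfl
  · rintro ⟨a, b, c, rfl⟩
    refine ⟨![a, b, c], fun f => ?_⟩
    rw [Fin.prod_univ_three]; rfl

lemma unitVec_iff_s4 (v : Q3 → ℂ) : UnitVec v ↔ vsq v = 1 := by
  have : ∑ i, star (v i) * v i = ((vsq v : ℝ) : ℂ) := by
    rw [vsq, Complex.ofReal_sum]
    refine Finset.sum_congr rfl fun i _ => ?_
    rw [nq_c, mul_comm]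
  rw [UnitVec, this]
  norm_cast

lemma trace_vecProj_s4 (v : Q3 → ℂ) : (vecProj v).trace = ((vsq v : ℝ) : ℂ) := by
  rw [vsq, Complex.ofReal_sum]
  refine Finset.sum_congr rfl fun i _ => ?_
  rw [nq_c]; rfl

lemma isState_vecProj (v : Q3 → ℂ) (h : vsq v = 1) : IsState (vecProj v) := by
  refine ⟨?_, by rw [trace_vecProj_s4, h]; simp⟩
  have : vecProj v = Matrix.vecMulVec v (star v) := rfl
  rw [this]
  exact Matrix.posSemidef_vecMulVec_self_star v

lemma fs_vecProj (a b c : Fin 2 → ℂ) (h : vsq (tp a b c) = 1) :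
    FullySepState (fun _ : Fin 3 => Fin 2) (vecProj (tp a b c)) := by
  refine ⟨1, fun _ => 1, fun _ => tp a b c, fun _ => zero_le_one, by simp, fun _ => ⟨?_, ?_⟩, by simp⟩
  · exact (unitVec_iff_s4 _).2 h
  · exact (isProdVec_iff _).2 ⟨a, b, c, rfl⟩

lemma vecProj_smul_s4 (c : ℂ) (v : Q3 → ℂ) : vecProj (c • v) = nq c • vecProj v := by
  ext i j
  simp only [vecProj, Matrix.of_apply, Matrix.smul_apply, Pi.smul_apply, smul_eq_mul, star_mul',
    Complex.real_smul, nq_c]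
  ring

/-- the GHZ witness functional -/
def Ffun : Matrix Q3 Q3 ℂ →ₗ[ℝ] ℝ where
  toFun ρ := (ρ.trace - ρ (fun _ => 0) (fun _ => 0) - ρ (fun _ => 1) (fun _ => 1)
    - 3 * (ρ (fun _ => 0) (fun _ => 1) + ρ (fun _ => 1) (fun _ => 0))).re
  map_add' A B := by
    simp [Matrix.trace_add]; ring
  map_smul' c A := by
    simp [Matrix.trace_smul]; ring

/-- the W fidelity functional -/
def Hfun : Matrix Q3 Q3 ℂ →ₗ[ℝ] ℝ where
  toFun ρ := (star wVec ⬝ᵥ (ρ *ᵥ wVec)).re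
  map_add' A B := by
    simp [Matrix.add_mulVec]
  map_smul' c A := by
    simp [Matrix.smul_mulVec]

/-- Kraus map -/
def kr {m : ℕ} (K : Fin m → Matrix Q3 Q3 ℂ) : Matrix Q3 Q3 ℂ →ₗ[ℝ] Matrix Q3 Q3 ℂ where
  toFun ρ := ∑ i, K i * ρ * (K i)ᴴ
  map_add' A B := by
    simp [Matrix.mul_add, Matrix.add_mul, Finset.sum_add_distrib]
  map_smul' c A := by
    simp [Finset.smul_sum]

lemma kr_vec {m : ℕ} (K : Fin m → Matrix Q3 Q3 ℂ) (v : Q3 → ℂ) :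
    kr K (vecProj v) = ∑ i, vecProj (K i *ᵥ v) := by
  have e : ∀ v : Q3 → ℂ, vecProj v = Matrix.vecMulVec v (star v) := fun _ => rfl
  show ∑ i, K i * vecProj v * (K i)ᴴ = _
  refine Finset.sum_congr rfl fun i _ => ?_
  rw [e, e, Matrix.mul_vecMulVec, Matrix.vecMulVec_mul, Matrix.star_mulVec]

lemma kr_vsq {m : ℕ} (K : Fin m → Matrix Q3 Q3 ℂ) (hK : ∑ i, (K i)ᴴ * K i = 1) (v : Q3 → ℂ) :
    ∑ i, vsq (K i *ᵥ v) = vsq v := by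
  have h1 : (kr K (vecProj v)).trace = (vecProj v).trace := by
    show (∑ i, K i * vecProj v * (K i)ᴴ).trace = _
    rw [Matrix.trace_sum]
    have : ∀ i, (K i * vecProj v * (K i)ᴴ).trace = ((K i)ᴴ * K i * vecProj v).trace := by
      intro i
      rw [Matrix.trace_mul_comm, Matrix.mul_assoc]
    simp_rw [this]
    rw [← Matrix.trace_sum, ← Finset.sum_mul, hK, one_mul]
  rw [kr_vec, Matrix.trace_sum] at h1
  simp_rw [trace_vecProj_s4] at h1
  exact_mod_cast h1

lemma F_vec (v : Q3 → ℂ) : Ffun (vecProj v) =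
    vsq v - nq (v fun _ => 0) - nq (v fun _ => 1) - 6 * (v (fun _ => 0) * star (v fun _ => 1)).re := by
  show ((vecProj v).trace - _ - _ - 3 * (_ + _)).re = _
  rw [trace_vecProj_s4]
  simp [vecProj, nq, Complex.normSq_apply]
  ring

lemma H_vec (v : Q3 → ℂ) : Hfun (vecProj v) = nq (star wVec ⬝ᵥ v) := by
  show (star wVec ⬝ᵥ (vecProj v *ᵥ wVec)).re = _
  have e : vecProj v = Matrix.vecMulVec v (star v) := rfl
  rw [e, Matrix.vecMulVec_mulVec]
  have : star v ⬝ᵥ wVec = star (star wVec ⬝ᵥ v) := by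
    rw [Matrix.star_dotProduct]
  rw [this, dotProduct_smul]
  simp [nq, Complex.normSq_apply]

lemma const_eq0 : (fun _ => 0 : Q3) = ![0, 0, 0] := by decide
lemma const_eq1 : (fun _ => 1 : Q3) = ![1, 1, 1] := by decide

lemma two_le_vsq (v : Q3 → ℂ) : nq (v fun _ => 0) + nq (v fun _ => 1) ≤ vsq v := by
  rw [const_eq0, const_eq1]
  simp only [vsq, sum3, Fin.sum_univ_two]
  have := fun i j k => Complex.normSq_nonneg (v ![i, j, k])
  simp only [nq]
  linarith [this 0 0 1, this 0 1 0, this 0 1 1, this 1 0 0, this 1 0 1, this 1 1 0]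

lemma re_le (z w : ℂ) : |2 * (z * star w).re| ≤ nq z + nq w := by
  have h1 := Complex.normSq_nonneg (z - w)
  have h2 := Complex.normSq_nonneg (z + w)
  rw [abs_le]
  simp only [Complex.normSq_apply, nq, Complex.sub_re, Complex.sub_im, Complex.add_re,
    Complex.add_im, Complex.mul_re, Complex.star_def, Complex.conj_re, Complex.conj_im] at *
  constructor <;> nlinarith

lemma F_le (v : Q3 → ℂ) : Ffun (vecProj v) ≤ 3 * vsq v := by
  rw [F_vec]
  have := two_le_vsq v
  have := abs_le.1 (re_le (v fun _ => 0) (v fun _ => 1))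
  linarith [this.1]

lemma F_ge (v : Q3 → ℂ) : -3 * vsq v ≤ Ffun (vecProj v) := by
  rw [F_vec]
  have := two_le_vsq v
  have := abs_le.1 (re_le (v fun _ => 0) (v fun _ => 1))
  linarith [this.2]

lemma F_prod (a b c : Fin 2 → ℂ) : 0 ≤ Ffun (vecProj (tp a b c)) ∧
    Ffun (vecProj (tp a b c)) ≤ 3 / 2 * vsq (tp a b c) := by
  rw [F_vec]
  set v := tp a b c with hv
  have r0 := abs_le.1 (re_le (v fun _ => 0) (v fun _ => 1))
  have key : ∀ z w : ℂ, nq z * nq w = nq (v fun _ => 0) * nq (v fun _ => 1) →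
      |2 * (v (fun _ => 0) * star (v fun _ => 1)).re| ≤ nq z + nq w := by
    intro z w h
    have h1 : |(v (fun _ => 0) * star (v fun _ => 1)).re| ≤ ‖v (fun _ => 0) * star (v fun _ => 1)‖ :=
      Complex.abs_re_le_norm _
    have h2 : ‖v (fun _ => 0) * star (v fun _ => 1)‖ = ‖z‖ * ‖w‖ := by
      rw [norm_mul, norm_star]
      simp only [nq, Complex.normSq_eq_norm_sq] at h
      rw [← mul_pow, ← mul_pow] at h
      exact ((sq_eq_sq₀ (by positivity) (by positivity)).1 h).symm
    rw [abs_mul, abs_two]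
    simp only [nq, Complex.normSq_eq_norm_sq]
    nlinarith [sq_nonneg (‖z‖ - ‖w‖)]
  have k1 := abs_le.1 (key (v ![0, 0, 1]) (v ![1, 1, 0]) (by simp [hv, tp, nq]; ring))
  have k2 := abs_le.1 (key (v ![0, 1, 0]) (v ![1, 0, 1]) (by simp [hv, tp, nq]; ring))
  have k3 := abs_le.1 (key (v ![1, 0, 0]) (v ![0, 1, 1]) (by simp [hv, tp, nq]; ring))
  have e : vsq v = nq (v fun _ => 0) + nq (v fun _ => 1) + (nq (v ![0, 0, 1]) + nq (v ![1, 1, 0]))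
      + (nq (v ![0, 1, 0]) + nq (v ![1, 0, 1])) + (nq (v ![1, 0, 0]) + nq (v ![0, 1, 1])) := by
    rw [const_eq0, const_eq1]
    simp only [vsq, sum3, Fin.sum_univ_two]
    ring
  constructor
  · linarith [k1.2, k2.2, k3.2]
  · linarith [k1.1, k2.1, k3.1, r0.1]

lemma w_dot (v : Q3 → ℂ) : star wVec ⬝ᵥ v =
    ((Real.sqrt 3)⁻¹ : ℝ) * (v ![0, 0, 1] + v ![0, 1, 0] + v ![1, 0, 0]) := by
  simp only [dotProduct, sum3, Fin.sum_univ_two, Pi.star_apply, wVec, Fin.sum_univ_three]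
  simp
  ring

lemma vsq_w : vsq wVec = 1 := by
  simp only [vsq, sum3, Fin.sum_univ_two, wVec, Fin.sum_univ_three]
  simp [nq, ← Complex.ofReal_inv, Complex.normSq_ofReal]
  have h3 : (Real.sqrt 3)⁻¹ * (Real.sqrt 3)⁻¹ = 1 / 3 := by
    rw [← mul_inv, Real.mul_self_sqrt (by norm_num)]; norm_num
  have h2 : (Real.sqrt 2)⁻¹ * (Real.sqrt 2)⁻¹ = 1 / 2 := by
    rw [← mul_inv, Real.mul_self_sqrt (by norm_num)]; norm_num
  linarith

lemma vsq_ghz : vsq ghzVec = 1 := by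
  simp only [vsq, sum3, Fin.sum_univ_two, ghzVec, const_eq0, const_eq1]
  simp [nq, ← Complex.ofReal_inv, Complex.normSq_ofReal]
  have h3 : (Real.sqrt 3)⁻¹ * (Real.sqrt 3)⁻¹ = 1 / 3 := by
    rw [← mul_inv, Real.mul_self_sqrt (by norm_num)]; norm_num
  have h2 : (Real.sqrt 2)⁻¹ * (Real.sqrt 2)⁻¹ = 1 / 2 := by
    rw [← mul_inv, Real.mul_self_sqrt (by norm_num)]; norm_num
  linarith

lemma F_ghz : Ffun (vecProj ghzVec) = -3 := by
  rw [F_vec, vsq_ghz]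
  simp only [ghzVec]
  simp [nq, ← Complex.ofReal_inv, Complex.normSq_ofReal]
  have h3 : (Real.sqrt 3)⁻¹ * (Real.sqrt 3)⁻¹ = 1 / 3 := by
    rw [← mul_inv, Real.mul_self_sqrt (by norm_num)]; norm_num
  have h2 : (Real.sqrt 2)⁻¹ * (Real.sqrt 2)⁻¹ = 1 / 2 := by
    rw [← mul_inv, Real.mul_self_sqrt (by norm_num)]; norm_num
  linarith

lemma H_w : Hfun (vecProj wVec) = 1 := by
  have : star wVec ⬝ᵥ wVec = 1 := (unitVec_iff_s4 wVec).2 vsq_w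
  rw [H_vec, this]; simp [nq]

lemma H_prod (a b c : Fin 2 → ℂ) : Hfun (vecProj (tp a b c)) ≤ 4 / 9 * vsq (tp a b c) := by
  rw [H_vec, w_dot, vsq_tp]
  simp only [nq, Complex.normSq_mul, Complex.normSq_ofReal, tp, n2]
  simp only [Complex.normSq_eq_norm_sq]
  simp only [Matrix.cons_val]
  have h3 : (Real.sqrt 3)⁻¹ * (Real.sqrt 3)⁻¹ = 1 / 3 := by
    rw [← mul_inv, Real.mul_self_sqrt (by norm_num)]; norm_num
  rw [h3]
  have t : ‖a 0 * b 0 * c 1 + a 0 * b 1 * c 0 + a 1 * b 0 * c 0‖ ≤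
      ‖a 0‖ * ‖b 0‖ * ‖c 1‖ + ‖a 0‖ * ‖b 1‖ * ‖c 0‖ + ‖a 1‖ * ‖b 0‖ * ‖c 0‖ := by
    refine (norm_add₃_le).trans ?_
    simp
  have t2 := pow_le_pow_left₀ (norm_nonneg _) t 2
  set x := ‖a 0‖
  set x' := ‖a 1‖
  set y := ‖b 0‖
  set y' := ‖b 1‖
  set z := ‖c 0‖
  set z' := ‖c 1‖
  have c1 : (x * y * z' + x * y' * z + x' * y * z) ^ 2 ≤
      (x ^ 2 + x' ^ 2) * ((y * z' + y' * z) ^ 2 + (y * z) ^ 2) := by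
    nlinarith [sq_nonneg (x * (y * z) - x' * (y * z' + y' * z))]
  have c2 : (y * z' + y' * z) ^ 2 + (y * z) ^ 2 ≤ 4 / 3 * ((y ^ 2 + y' ^ 2) * (z ^ 2 + z' ^ 2)) := by
    nlinarith [sq_nonneg (y * z' - y' * z), sq_nonneg (y * z - 2 * (y' * z'))]
  have c3 := mul_le_mul_of_nonneg_left c2 (by positivity : 0 ≤ x ^ 2 + x' ^ 2)
  linarith

lemma fs_bounds (ρ : Matrix Q3 Q3 ℂ) (h : FullySepState (fun _ : Fin 3 => Fin 2) ρ) :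
    0 ≤ Ffun ρ ∧ Ffun ρ ≤ 3 / 2 ∧ Hfun ρ ≤ 4 / 9 := by
  obtain ⟨m, w, u, hw, h1, hu, rfl⟩ := h
  have e : ∀ k, ((w k : ℝ) : ℂ) • vecProj (u k) = w k • vecProj (u k) := fun k => by
    ext i j; simp
  have hb : ∀ k, 0 ≤ Ffun (vecProj (u k)) ∧ Ffun (vecProj (u k)) ≤ 3 / 2 ∧
      Hfun (vecProj (u k)) ≤ 4 / 9 := by
    intro k
    obtain ⟨a, b, c, hab⟩ := (isProdVec_iff _).1 (hu k).2
    have h1 := (unitVec_iff_s4 _).1 (hu k).1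
    have p1 := F_prod a b c
    have p2 := H_prod a b c
    rw [← hab, h1] at p1 p2
    exact ⟨p1.1, by linarith [p1.2], by linarith⟩
  have s : ∀ L : Matrix Q3 Q3 ℂ →ₗ[ℝ] ℝ, L (∑ k, ((w k : ℝ) : ℂ) • vecProj (u k)) =
      ∑ k, w k * L (vecProj (u k)) := by
    intro L
    simp_rw [e]
    simp
  rw [s, s]
  refine ⟨Finset.sum_nonneg fun k _ => mul_nonneg (hw k) (hb k).1, ?_, ?_⟩
  · calc _ ≤ ∑ k, w k * (3 / 2) := Finset.sum_le_sum fun k _ =>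
        mul_le_mul_of_nonneg_left (hb k).2.1 (hw k)
      _ = 3 / 2 := by rw [← Finset.sum_mul, h1, one_mul]
  · calc _ ≤ ∑ k, w k * (4 / 9) := Finset.sum_le_sum fun k _ =>
        mul_le_mul_of_nonneg_left (hb k).2.2 (hw k)
      _ = 4 / 9 := by rw [← Finset.sum_mul, h1, one_mul]

/-- full separability preservation of a Kraus family -/
def FSPK {m : ℕ} (K : Fin m → Matrix Q3 Q3 ℂ) : Prop :=
  ∀ σ, IsState σ → FullySepState (fun _ : Fin 3 => Fin 2) σ →
    FullySepState (fun _ : Fin 3 => Fin 2) (kr K σ)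

lemma vecProj_zero_of (v : Q3 → ℂ) (h : vsq v = 0) : vecProj v = 0 := by
  have h0 : ∀ f, v f = 0 := by
    intro f
    have := (Finset.sum_eq_zero_iff_of_nonneg (fun i _ => Complex.normSq_nonneg (v i))).1 h f
      (Finset.mem_univ f)
    exact Complex.normSq_eq_zero.1 this
  ext i j
  simp [vecProj, h0]

lemma tp_smul (s : ℂ) (a b c : Fin 2 → ℂ) : tp (s • a) b c = s • tp a b c := by
  funext f; simp [tp]; ring

lemma prod_bounds {m : ℕ} (K : Fin m → Matrix Q3 Q3 ℂ) (hP : FSPK K) (a b c : Fin 2 → ℂ) :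
    0 ≤ Ffun (kr K (vecProj (tp a b c))) ∧
    Ffun (kr K (vecProj (tp a b c))) ≤ 3 / 2 * vsq (tp a b c) ∧
    Hfun (kr K (vecProj (tp a b c))) ≤ 4 / 9 * vsq (tp a b c) := by
  by_cases h0 : vsq (tp a b c) = 0
  · rw [vecProj_zero_of _ h0, h0]; simp
  have hpos : 0 < vsq (tp a b c) := lt_of_le_of_ne (vsq_nonneg _) (Ne.symm h0)
  set r := vsq (tp a b c) with hr
  set s : ℂ := (((Real.sqrt r)⁻¹ : ℝ) : ℂ) with hs
  have hsn : nq s = r⁻¹ := by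
    rw [hs, nq, Complex.normSq_ofReal, ← mul_inv, Real.mul_self_sqrt hpos.le]
  have hu : vsq (tp (s • a) b c) = 1 := by
    rw [tp_smul, vsq_smul, hsn, ← hr, inv_mul_cancel₀ h0]
  have := fs_bounds _ (hP _ (isState_vecProj _ hu) (fs_vecProj _ _ _ hu))
  rw [tp_smul, vecProj_smul_s4, hsn] at this
  simp only [map_smul, smul_eq_mul] at this
  obtain ⟨p1, p2, p3⟩ := this
  rw [inv_mul_le_iff₀ hpos] at p2 p3
  refine ⟨?_, by linarith, by linarith⟩
  have := mul_nonneg hpos.le p1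
  rwa [mul_inv_cancel_left₀ h0] at this

lemma gen_bounds {m : ℕ} (K : Fin m → Matrix Q3 Q3 ℂ) (hK : ∑ i, (K i)ᴴ * K i = 1)
    (v : Q3 → ℂ) : -3 * vsq v ≤ Ffun (kr K (vecProj v)) ∧ Ffun (kr K (vecProj v)) ≤ 3 * vsq v := by
  rw [kr_vec, map_sum, ← kr_vsq K hK v, Finset.mul_sum, Finset.mul_sum]
  exact ⟨Finset.sum_le_sum fun i _ => F_ge _, Finset.sum_le_sum fun i _ => F_le _⟩

/-- the W-type vector of three frames -/
def wt (a0 a1 b0 b1 c0 c1 : Fin 2 → ℂ) : Q3 → ℂ :=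
  tp a1 b0 c0 + tp a0 b1 c0 + tp a0 b0 c1

lemma mix (a0 a1 b0 b1 c0 c1 : Fin 2 → ℂ) :
    vecProj (tp (a0 + (1 / 2 : ℂ) • a1) (b0 + (1 / 2 : ℂ) • b1) (c0 + (1 / 2 : ℂ) • c1))
    + vecProj (tp (a0 + (-1 / 2 : ℂ) • a1) (b0 + (-1 / 2 : ℂ) • b1) (c0 + (-1 / 2 : ℂ) • c1))
    + vecProj (tp (a0 + (Complex.I / 2 : ℂ) • a1) (b0 + (Complex.I / 2 : ℂ) • b1)
        (c0 + (Complex.I / 2 : ℂ) • c1))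
    + vecProj (tp (a0 + (-Complex.I / 2 : ℂ) • a1) (b0 + (-Complex.I / 2 : ℂ) • b1)
        (c0 + (-Complex.I / 2 : ℂ) • c1))
    = (4 : ℝ) • vecProj (tp a0 b0 c0) + (1 : ℝ) • vecProj (wt a0 a1 b0 b1 c0 c1)
      + (1 / 4 : ℝ) • vecProj (wt a1 a0 b1 b0 c1 c0) + (1 / 16 : ℝ) • vecProj (tp a1 b1 c1) := by
  have q : ∀ (s : ℂ) (f : Q3), tp (a0 + s • a1) (b0 + s • b1) (c0 + s • c1) f =
      tp a0 b0 c0 f + s * wt a0 a1 b0 b1 c0 c1 f + s ^ 2 * wt a1 a0 b1 b0 c1 c0 f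
        + s ^ 3 * tp a1 b1 c1 f := by
    intro s f
    simp [tp, wt]; ring
  ext i j
  simp only [Matrix.add_apply, Matrix.smul_apply, vecProj, Matrix.of_apply, q]
  generalize tp a0 b0 c0 i = A
  generalize wt a0 a1 b0 b1 c0 c1 i = B
  generalize wt a1 a0 b1 b0 c1 c0 i = C
  generalize tp a1 b1 c1 i = D
  generalize tp a0 b0 c0 j = A'
  generalize wt a0 a1 b0 b1 c0 c1 j = B'
  generalize wt a1 a0 b1 b0 c1 c0 j = C'
  generalize tp a1 b1 c1 j = D'
  simp only [star_add, star_mul', star_pow, star_div₀, star_neg, star_one, star_ofNat,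
    Complex.star_def, Complex.conj_I, Complex.real_smul]
  push_cast
  have hI := Complex.I_sq
  have hI4 : Complex.I ^ 4 = 1 := by rw [show 4 = 2 * 2 from rfl, pow_mul, hI]; ring
  have hI6 : Complex.I ^ 6 = -1 := by rw [show 6 = 2 * 3 from rfl, pow_mul, hI]; ring
  ring_nf
  simp only [hI, hI4, hI6]
  ring

lemma n2_onp {a0 a1 : Fin 2 → ℂ} (h : ONP a0 a1) : n2 a0 = 1 ∧ n2 a1 = 1 := by
  obtain ⟨h1, h2, _⟩ := h
  rw [← nq_c, ← nq_c] at h1 h2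
  exact ⟨by simp only [n2]; exact_mod_cast h1, by simp only [n2]; exact_mod_cast h2⟩

lemma onp_symm {a0 a1 : Fin 2 → ℂ} (h : ONP a0 a1) : ONP a1 a0 := by
  obtain ⟨h1, h2, h3⟩ := h
  refine ⟨h2, h1, ?_⟩
  have := congrArg star h3
  simp only [star_add, star_mul', star_star, star_zero] at this
  rw [← this]; ring

lemma vsq_wt {a0 a1 b0 b1 c0 c1 : Fin 2 → ℂ} (ha : ONP a0 a1) (hb : ONP b0 b1) (hc : ONP c0 c1) :
    vsq (wt a0 a1 b0 b1 c0 c1) = 3 := by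
  have key : ((vsq (wt a0 a1 b0 b1 c0 c1) : ℝ) : ℂ) = 3 := by
    rw [vsq, Complex.ofReal_sum]
    simp_rw [nq_c]
    simp only [sum3, Fin.sum_univ_two, wt, tp, Pi.add_apply, star_add, star_mul', Matrix.cons_val]
    obtain ⟨a1', a2, a3⟩ := ha
    obtain ⟨b1', b2, b3⟩ := hb
    obtain ⟨c1', c2, c3⟩ := hc
    have a4 := congrArg star a3
    have b4 := congrArg star b3
    have c4 := congrArg star c3
    simp only [star_add, star_mul', star_star, star_zero] at a4 b4 c4
    calc _ = (a1 0 * star (a1 0) + a1 1 * star (a1 1)) * (b0 0 * star (b0 0) + b0 1 * star (b0 1)) * (c0 0 * star (c0 0) + c0 1 * star (c0 1))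
        + (a0 0 * star (a0 0) + a0 1 * star (a0 1)) * (b1 0 * star (b1 0) + b1 1 * star (b1 1)) * (c0 0 * star (c0 0) + c0 1 * star (c0 1))
        + (a0 0 * star (a0 0) + a0 1 * star (a0 1)) * (b0 0 * star (b0 0) + b0 1 * star (b0 1)) * (c1 0 * star (c1 0) + c1 1 * star (c1 1))
        + (star (a0 0) * a1 0 + star (a0 1) * a1 1) * (b0 0 * star (b1 0) + b0 1 * star (b1 1)) * (c0 0 * star (c0 0) + c0 1 * star (c0 1))
        + (a0 0 * star (a1 0) + a0 1 * star (a1 1)) * (star (b0 0) * b1 0 + star (b0 1) * b1 1) * (c0 0 * star (c0 0) + c0 1 * star (c0 1))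
        + (star (a0 0) * a1 0 + star (a0 1) * a1 1) * (c0 0 * star (c1 0) + c0 1 * star (c1 1)) * (b0 0 * star (b0 0) + b0 1 * star (b0 1))
        + (a0 0 * star (a1 0) + a0 1 * star (a1 1)) * (star (c0 0) * c1 0 + star (c0 1) * c1 1) * (b0 0 * star (b0 0) + b0 1 * star (b0 1))
        + (star (b0 0) * b1 0 + star (b0 1) * b1 1) * (c0 0 * star (c1 0) + c0 1 * star (c1 1)) * (a0 0 * star (a0 0) + a0 1 * star (a0 1))
        + (b0 0 * star (b1 0) + b0 1 * star (b1 1)) * (star (c0 0) * c1 0 + star (c0 1) * c1 1) * (a0 0 * star (a0 0) + a0 1 * star (a0 1)) := by ring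
      _ = 3 := by rw [a1', a2, a3, a4, b1', b2, b3, b4, c1', c2, c3, c4]; norm_num
  exact_mod_cast key

lemma no_W {m : ℕ} (K : Fin m → Matrix Q3 Q3 ℂ) (hK : ∑ i, (K i)ᴴ * K i = 1) (hP : FSPK K)
    {a0 a1 b0 b1 c0 c1 : Fin 2 → ℂ} (ha : ONP a0 a1) (hb : ONP b0 b1) (hc : ONP c0 c1)
    (φ : Q3 → ℂ) (hφ : ((Real.sqrt 3 : ℝ) : ℂ) • φ = wt a0 a1 b0 b1 c0 c1)
    (hF : Ffun (kr K (vecProj φ)) = -3) : False := by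
  have h := congrArg (fun M => Ffun (kr K M)) (mix a0 a1 b0 b1 c0 c1)
  simp only [map_add, map_smul, smul_eq_mul] at h
  have e : vecProj (wt a0 a1 b0 b1 c0 c1) = (3 : ℝ) • vecProj φ := by
    rw [← hφ, vecProj_smul_s4, nq, Complex.normSq_ofReal, Real.mul_self_sqrt (by norm_num)]
  rw [e, map_smul, map_smul, hF] at h
  have q1 := (prod_bounds K hP (a0 + (1 / 2 : ℂ) • a1) (b0 + (1 / 2 : ℂ) • b1) (c0 + (1 / 2 : ℂ) • c1)).1
  have q2 := (prod_bounds K hP (a0 + (-1 / 2 : ℂ) • a1) (b0 + (-1 / 2 : ℂ) • b1) (c0 + (-1 / 2 : ℂ) • c1)).1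
  have q3 := (prod_bounds K hP (a0 + (Complex.I / 2 : ℂ) • a1) (b0 + (Complex.I / 2 : ℂ) • b1)
        (c0 + (Complex.I / 2 : ℂ) • c1)).1
  have q4 := (prod_bounds K hP (a0 + (-Complex.I / 2 : ℂ) • a1) (b0 + (-Complex.I / 2 : ℂ) • b1)
        (c0 + (-Complex.I / 2 : ℂ) • c1)).1
  have q5 := (prod_bounds K hP a0 b0 c0).2.1
  have q6 := (prod_bounds K hP a1 b1 c1).2.1
  have q7 := (gen_bounds K hK (wt a1 a0 b1 b0 c1 c0)).2
  rw [vsq_wt (onp_symm ha) (onp_symm hb) (onp_symm hc)] at q7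
  rw [vsq_tp, (n2_onp ha).1, (n2_onp hb).1, (n2_onp hc).1] at q5
  rw [vsq_tp, (n2_onp ha).2, (n2_onp hb).2, (n2_onp hc).2] at q6
  simp only [smul_eq_mul] at h
  linarith

lemma onp_std : ONP ![1, 0] ![0, 1] := by
  simp [ONP]

lemma w_form : ((Real.sqrt 3 : ℝ) : ℂ) • wVec = wt ![1, 0] ![0, 1] ![1, 0] ![0, 1] ![1, 0] ![0, 1] := by
  have h3 : ((Real.sqrt 3 : ℝ) : ℂ) ≠ 0 := by
    have : (Real.sqrt 3 : ℝ) ≠ 0 := by positivity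
    exact_mod_cast this
  funext f
  obtain ⟨i, j, k, rfl⟩ : ∃ i j k, f = ![i, j, k] := ⟨f 0, f 1, f 2, by
    funext i; fin_cases i <;> rfl⟩
  fin_cases i <;> fin_cases j <;> fin_cases k <;>
    simp [wVec, wt, tp, Fin.sum_univ_three, h3]

lemma cs {ι : Type*} (s : Finset ι) (x y : ι → ℂ) :
    nq (∑ i ∈ s, x i * y i) ≤ (∑ i ∈ s, nq (x i)) * ∑ i ∈ s, nq (y i) := by
  simp only [nq, Complex.normSq_eq_norm_sq]
  have h1 : ‖∑ i ∈ s, x i * y i‖ ≤ ∑ i ∈ s, ‖x i‖ * ‖y i‖ := by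
    refine (norm_sum_le _ _).trans (le_of_eq ?_)
    simp
  exact (pow_le_pow_left₀ (norm_nonneg _) h1 2).trans (Finset.sum_mul_sq_le_sq_mul_sq _ _ _)

lemma nq_star (z : ℂ) : nq (star z) = nq z := by
  simp [nq]

lemma cs_dot (x y : Q3 → ℂ) : nq (star x ⬝ᵥ y) ≤ vsq x * vsq y := by
  have := cs Finset.univ (fun f => star (x f)) y
  simp only [nq_star] at this
  exact this

lemma H_gen {m : ℕ} (K : Fin m → Matrix Q3 Q3 ℂ) (hK : ∑ i, (K i)ᴴ * K i = 1)
    (v : Q3 → ℂ) : Hfun (kr K (vecProj v)) ≤ vsq v := by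
  rw [kr_vec, map_sum, ← kr_vsq K hK v]
  refine Finset.sum_le_sum fun i _ => ?_
  rw [H_vec]
  have := cs_dot wVec (K i *ᵥ v)
  rwa [vsq_w, one_mul] at this

lemma self_dot (v : Q3 → ℂ) : star v ⬝ᵥ v = ((vsq v : ℝ) : ℂ) := by
  rw [vsq, Complex.ofReal_sum]
  refine Finset.sum_congr rfl fun i _ => ?_
  rw [nq_c, mul_comm]; rfl

lemma overlap {m : ℕ} (K : Fin m → Matrix Q3 Q3 ℂ) (hK : ∑ i, (K i)ᴴ * K i = 1)
    (φ : Q3 → ℂ) (h1 : vsq φ = 1) (hH : Hfun (kr K (vecProj φ)) = 1) (v : Q3 → ℂ) :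
    nq (star φ ⬝ᵥ v) ≤ Hfun (kr K (vecProj v)) := by
  have hQ : ∀ v, Hfun (kr K (vecProj v)) = ∑ i, nq (star wVec ⬝ᵥ (K i *ᵥ v)) := by
    intro v
    rw [kr_vec, map_sum]
    exact Finset.sum_congr rfl fun i _ => H_vec _
  set η : Q3 → ℂ := ∑ i, (star wVec ⬝ᵥ (K i *ᵥ φ)) • ((K i)ᴴ *ᵥ wVec) with hη
  have hd : ∀ v, star η ⬝ᵥ v = ∑ i, star (star wVec ⬝ᵥ (K i *ᵥ φ)) * (star wVec ⬝ᵥ (K i *ᵥ v)) := by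
    intro v
    rw [hη, star_sum, sum_dotProduct]
    refine Finset.sum_congr rfl fun i _ => ?_
    rw [star_smul, smul_dotProduct, Matrix.star_mulVec, Matrix.conjTranspose_conjTranspose,
      ← Matrix.dotProduct_mulVec, smul_eq_mul]
  have hle : ∀ v, nq (star η ⬝ᵥ v) ≤ Hfun (kr K (vecProj v)) := by
    intro v
    have := cs Finset.univ (fun i => star (star wVec ⬝ᵥ (K i *ᵥ φ))) (fun i => star wVec ⬝ᵥ (K i *ᵥ v))
    simp only [nq_star] at this
    rw [← hd, ← hQ, ← hQ, hH, one_mul] at this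
    exact this
  have hη1 : vsq η ≤ 1 := by
    have h2 := (hle η).trans (H_gen K hK η)
    rw [self_dot, nq, Complex.normSq_ofReal] at h2
    nlinarith [vsq_nonneg η]
  have hηφ : star η ⬝ᵥ φ = 1 := by
    have : star η ⬝ᵥ φ = ((Hfun (kr K (vecProj φ)) : ℝ) : ℂ) := by
      rw [hd, hQ, Complex.ofReal_sum]
      refine Finset.sum_congr rfl fun i _ => ?_
      rw [nq_c, mul_comm]
    rw [this, hH]; simp
  have hφη : star φ ⬝ᵥ η = 1 := by
    have := congrArg star hηφ
    rw [← Matrix.star_dotProduct] at this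
    simpa using this
  have hdiff : vsq (φ - η) = vsq η - 1 := by
    have : ((vsq (φ - η) : ℝ) : ℂ) = ((vsq η - 1 : ℝ) : ℂ) := by
      rw [← self_dot, star_sub, sub_dotProduct, dotProduct_sub, dotProduct_sub, self_dot, self_dot,
        hηφ, hφη, h1]
      push_cast; ring
    exact_mod_cast this
  have h0 : vsq (φ - η) = 0 := le_antisymm (by linarith) (vsq_nonneg _)
  have heq : φ = η := by
    funext f
    have := (Finset.sum_eq_zero_iff_of_nonneg (fun i _ => Complex.normSq_nonneg ((φ - η) i))).1 h0 f
      (Finset.mem_univ f)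
    exact sub_eq_zero.1 (Complex.normSq_eq_zero.1 this)
  rw [heq]
  exact hle v

lemma spectral (ρ : Matrix Q3 Q3 ℂ) (h : IsState ρ) :
    ∃ (w : Q3 → ℝ) (u : Q3 → Q3 → ℂ), (∀ k, 0 ≤ w k) ∧ ∑ k, w k = 1 ∧ (∀ k, vsq (u k) = 1) ∧
      ρ = ∑ k, w k • vecProj (u k) := by
  obtain ⟨hp, ht⟩ := h
  set U := hp.1.eigenvectorUnitary with hU
  have hs := hp.1.spectral_theorem
  rw [Unitary.conjStarAlgAut_apply] at hs
  have hdec : ρ = ∑ k, hp.1.eigenvalues k • vecProj (fun f => (U : Matrix Q3 Q3 ℂ) f k) := by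
    conv_lhs => rw [hs]
    ext i j
    rw [Matrix.mul_apply, Matrix.sum_apply]
    refine Finset.sum_congr rfl fun k _ => ?_
    rw [Matrix.mul_diagonal]
    simp [vecProj, Matrix.star_apply, hU]
    ring
  have hu : ∀ k, vsq (fun f => (U : Matrix Q3 Q3 ℂ) f k) = 1 := by
    intro k
    have h1 : star (U : Matrix Q3 Q3 ℂ) * (U : Matrix Q3 Q3 ℂ) = 1 := Unitary.coe_star_mul_self U
    have h2 := congrFun (congrFun h1 k) k
    rw [Matrix.mul_apply, Matrix.one_apply_eq] at h2
    exact (unitVec_iff_s4 _).1 h2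
  refine ⟨hp.1.eigenvalues, fun k f => (U : Matrix Q3 Q3 ℂ) f k, hp.eigenvalues_nonneg, ?_, hu, hdec⟩
  rw [hdec, Matrix.trace_sum] at ht
  simp_rw [Matrix.trace_smul, trace_vecProj_s4, hu] at ht
  simp at ht
  exact_mod_cast ht

lemma final_contra {m m' : ℕ} (K : Fin m → Matrix Q3 Q3 ℂ) (hK : ∑ i, (K i)ᴴ * K i = 1)
    (hP : FSPK K) (K' : Fin m' → Matrix Q3 Q3 ℂ) (hK' : ∑ i, (K' i)ᴴ * K' i = 1)
    (hP' : FSPK K') (ρ : Matrix Q3 Q3 ℂ) (hρ : IsState ρ) (hW : kr K ρ = vecProj wVec)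
    (hG : kr K' ρ = vecProj ghzVec) : False := by
  obtain ⟨w, u, hw, hw1, hu, hd⟩ := spectral ρ hρ
  obtain ⟨k, hk⟩ : ∃ k, 0 < w k := by
    by_contra hcon
    push Not at hcon
    have := Finset.sum_nonpos fun k (_ : k ∈ Finset.univ) => hcon k
    linarith
  have hH : Hfun (kr K (vecProj (u k))) = 1 := by
    have e : ∑ k, w k * (1 - Hfun (kr K (vecProj (u k)))) = 0 := by
      have := H_w
      rw [← hW, hd] at this
      simp only [map_sum, map_smul, smul_eq_mul] at this
      simp only [mul_sub, mul_one, Finset.sum_sub_distrib, hw1, this, sub_self]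
    have := (Finset.sum_eq_zero_iff_of_nonneg (fun k _ => mul_nonneg (hw k)
      (by have := H_gen K hK (u k); rw [hu] at this; linarith))).1 e k (Finset.mem_univ k)
    rcases mul_eq_zero.1 this with h | h <;> linarith
  have hF : Ffun (kr K' (vecProj (u k))) = -3 := by
    have e : ∑ k, w k * (Ffun (kr K' (vecProj (u k))) + 3) = 0 := by
      have := F_ghz
      rw [← hG, hd] at this
      simp only [map_sum, map_smul, smul_eq_mul] at this
      simp only [mul_add, Finset.sum_add_distrib, ← Finset.sum_mul, hw1, this]
      norm_num
    have := (Finset.sum_eq_zero_iff_of_nonneg (fun k _ => mul_nonneg (hw k)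
      (by have := (gen_bounds K' hK' (u k)).1; rw [hu] at this; linarith))).1 e k (Finset.mem_univ k)
    rcases mul_eq_zero.1 this with h | h <;> linarith
  set φ := u k with hφ
  obtain ⟨a0, a1, b0, b1, c0, c1, ha, hb, hc, hform⟩ := W_unique (fun i j k => φ ![i, j, k])
    (by rw [← hu k, vsq, sum3]) (by
      intro x y z
      have h1 := (overlap K hK φ (hu k) hH (tp (star x) (star y) (star z))).trans
        (prod_bounds K hP (star x) (star y) (star z)).2.2
      rw [vsq_tp] at h1
      have h2 : ∀ x : Fin 2 → ℂ, n2 (star x) = n2 x := fun x => by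
        simp only [n2, Pi.star_apply, nq_star]
      rw [h2, h2, h2] at h1
      refine le_trans (le_of_eq ?_) h1
      rw [← nq_star]
      congr 1
      rw [dotProduct, sum3]
      simp only [star_sum, star_mul', tp, Pi.star_apply, Matrix.cons_val])
  refine no_W K' hK' hP' ha hb hc φ ?_ hF
  funext f
  have := hform (f 0) (f 1) (f 2)
  have ef : ![f 0, f 1, f 2] = f := by funext i; fin_cases i <;> rfl
  rw [ef] at this
  exact this

/-- In the resource theory whose free operations are the full separability-preserving
(FSP) maps, there is no maximally entangled state on `(ℂ²)^{⊗3}`; in particular there is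
no CPTP FSP map taking the W state to the GHZ state. -/
theorem no_maximally_entangled_state_FSP :
    (¬ ∃ ρs : Matrix (Fin 3 → Fin 2) (Fin 3 → Fin 2) ℂ, IsState ρs ∧
      ∀ ρ : Matrix (Fin 3 → Fin 2) (Fin 3 → Fin 2) ℂ, IsState ρ →
        ∃ Λ : Matrix (Fin 3 → Fin 2) (Fin 3 → Fin 2) ℂ →
              Matrix (Fin 3 → Fin 2) (Fin 3 → Fin 2) ℂ,
          IsCPTP Λ ∧
          (∀ σ, IsState σ → FullySepState (fun _ : Fin 3 => Fin 2) σ →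
            FullySepState (fun _ : Fin 3 => Fin 2) (Λ σ)) ∧
          Λ ρs = ρ) ∧
    ¬ ∃ Λ : Matrix (Fin 3 → Fin 2) (Fin 3 → Fin 2) ℂ →
            Matrix (Fin 3 → Fin 2) (Fin 3 → Fin 2) ℂ,
        IsCPTP Λ ∧
        (∀ σ, IsState σ → FullySepState (fun _ : Fin 3 => Fin 2) σ →
          FullySepState (fun _ : Fin 3 => Fin 2) (Λ σ)) ∧
        Λ (vecProj wVec) = vecProj ghzVec := by
  constructor
  · rintro ⟨ρ, hρ, h⟩
    obtain ⟨Λ, ⟨m, K, hΛ, hK⟩, hP, hW⟩ := h _ (isState_vecProj wVec vsq_w)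
    obtain ⟨Λ', ⟨m', K', hΛ', hK'⟩, hP', hG⟩ := h _ (isState_vecProj ghzVec vsq_ghz)
    have e : ∀ σ, kr K σ = Λ σ := fun σ => (hΛ σ).symm
    have e' : ∀ σ, kr K' σ = Λ' σ := fun σ => (hΛ' σ).symm
    refine final_contra K hK (fun σ h1 h2 => ?_) K' hK' (fun σ h1 h2 => ?_) ρ hρ ?_ ?_
    · rw [e]; exact hP σ h1 h2
    · rw [e']; exact hP' σ h1 h2
    · rw [e]; exact hW
    · rw [e']; exact hG
  · rintro ⟨Λ, ⟨m, K, hΛ, hK⟩, hP, hW⟩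
    have e : ∀ σ, kr K σ = Λ σ := fun σ => (hΛ σ).symm
    refine no_W K hK (fun σ h1 h2 => ?_) onp_std onp_std onp_std wVec w_form ?_
    · rw [e]; exact hP σ h1 h2
    · rw [e, hW, F_ghz]
end
end
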